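/- arXiv:1607.08850 — 3 statements merged into one kernel-verified Lean document; each statement's English description precedes it below -/
import Mathlib

section
/- Let G be a connected finite graph on n vertices and let P be a set of exactly 4 longest paths of G. Then f(G,P) ≤ (3n - 4)/16; in particular 16·f(G,P) ≤ 3n. -/
open SimpleGraph

/-- `w` is a longest path of `G`: it is a path and no path of `G` is longer. -/
def IsLongestPath {V : Type*} (G : SimpleGraph V) {u v : V} (w : G.Walk u v) : Prop :=
  w.IsPath ∧ ∀ (a b : V) (q : G.Walk a b), q.IsPath → q.length ≤ w.length

/-- The distance `d_G(x, V(w))` from a vertex `x` to the vertex set of a walk `w`. -/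
noncomputable def distToWalk {V : Type*} (G : SimpleGraph V) (x : V) {u v : V}
    (w : G.Walk u v) : ℕ :=
  sInf {d : ℕ | ∃ y ∈ w.support, G.dist x y = d}

/-- The path-distance-function `f(G, 𝒫)` of a family `𝒫` of paths of `G`. -/
noncomputable def pdf {V : Type*} (G : SimpleGraph V) {k : ℕ}
    (P : Fin k → Σ u : V, Σ v : V, G.Walk u v) : ℕ :=
  sInf {s : ℕ | ∃ x : V, s = ∑ i, distToWalk G x (P i).2.2}

section LongestPaths

variable {V : Type*} {G : SimpleGraph V}

lemma isPath_append_of_inter {a b c : V} {p : G.Walk a b} {q : G.Walk b c} (hp : p.IsPath)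
    (hq : q.IsPath) (h : ∀ x ∈ p.support, x ∈ q.support → x = b) : (p.append q).IsPath := by
  rw [Walk.isPath_def, Walk.support_append, List.nodup_append']
  refine ⟨hp.support_nodup, hq.support_nodup.tail, fun x hx hx' => ?_⟩
  have hxb := h x hx (List.mem_of_mem_tail hx')
  have hn := hq.support_nodup
  rw [← Walk.cons_tail_support] at hn
  exact (List.nodup_cons.1 hn).1 (hxb ▸ hx')

lemma exists_segment {u v : V} {p : G.Walk u v} (hp : p.IsPath) {i j : ℕ} (hij : i ≤ j)
    (hj : j ≤ p.length) :
    ∃ s : G.Walk (p.getVert i) (p.getVert j), s.IsPath ∧ s.length = j - i ∧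
      ∀ x ∈ s.support, ∃ k, i ≤ k ∧ k ≤ j ∧ p.getVert k = x := by
  have e : (p.drop i).getVert (j - i) = p.getVert j := by
    rw [Walk.drop_getVert]; congr 1; omega
  refine ⟨((p.drop i).take (j - i)).copy rfl e, ?_, ?_, ?_⟩
  · simpa using (hp.drop i).take (j - i)
  · simp [Walk.take_length, Walk.drop_length]; omega
  · intro x hx
    rw [Walk.support_copy, Walk.mem_support_iff_exists_getVert] at hx
    obtain ⟨n, rfl, hn⟩ := hx
    rw [Walk.take_length, Walk.drop_length] at hn
    refine ⟨i + n, by omega, by omega, ?_⟩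
    rw [Walk.take_getVert, Walk.drop_getVert]
    congr 1; omega

lemma getVert_inj {u v : V} {p : G.Walk u v} (hp : p.IsPath) {i j : ℕ} (hi : i ≤ p.length)
    (hj : j ≤ p.length) (h : p.getVert i = p.getVert j) : i = j :=
  hp.getVert_injOn hi hj h

lemma exists_path_to_first_hit {a b : V} (w : G.Walk a b) (T : Set V) (hb : b ∈ T) :
    ∃ y ∈ T, ∃ r : G.Walk a y, r.IsPath ∧ (∀ x ∈ r.support, x ∈ w.support) ∧
      ∀ x ∈ r.support, x ∈ T → x = y := by
  classical
  have hw : w.bypass.IsPath := w.bypass_isPath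
  have hex : ∃ n, w.bypass.getVert n ∈ T := ⟨w.bypass.length, by simpa using hb⟩
  have hle : Nat.find hex ≤ w.bypass.length := Nat.find_le (by simpa using hb)
  obtain ⟨s, hs, -, hs'⟩ := exists_segment hw (Nat.zero_le _) hle
  refine ⟨_, Nat.find_spec hex, s.copy (by simp) rfl, by simpa using hs, ?_, ?_⟩
  · intro x hx
    obtain ⟨k, -, -, rfl⟩ := hs' x (by simpa using hx)
    exact w.support_bypass_subset_support (Walk.getVert_mem_support _ _)
  · intro x hx hxT
    obtain ⟨k, -, hk, rfl⟩ := hs' x (by simpa using hx)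
    rw [le_antisymm hk (Nat.find_le hxT)]

lemma exists_path_from_last_hit {a b : V} (w : G.Walk a b) (T : Set V) (ha : a ∈ T) :
    ∃ y ∈ T, ∃ r : G.Walk y b, r.IsPath ∧ (∀ x ∈ r.support, x ∈ w.support) ∧
      ∀ x ∈ r.support, x ∈ T → x = y := by
  obtain ⟨y, hy, r, hr, h1, h2⟩ := exists_path_to_first_hit w.reverse T ha
  exact ⟨y, hy, r.reverse, hr.reverse, by simpa using h1, by simpa using h2⟩

/-- A path leaving a longest path has at most half its length. -/
lemma IsLongestPath.two_mul_length_le_of_tail {u v a b : V} {q : G.Walk u v}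
    (hq : IsLongestPath G q) (ha : a ∈ q.support) {r : G.Walk a b} (hr : r.IsPath)
    (h : ∀ x ∈ r.support, x ∈ q.support → x = a) : 2 * r.length ≤ q.length := by
  obtain ⟨i, rfl, hi⟩ := Walk.mem_support_iff_exists_getVert.1 ha
  have key : ∀ {c} (s : G.Walk c (q.getVert i)), s.IsPath → (∀ x ∈ s.support, x ∈ q.support) →
      s.length + r.length ≤ q.length := by
    intro c s hs hs'
    have := hq.2 _ _ (s.append r)
      (isPath_append_of_inter hs hr fun x hx hx' => h x hx' (hs' x hx))
    simpa using this
  obtain ⟨s, hs, hsl, hs'⟩ := exists_segment hq.1 (Nat.zero_le i) hi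
  obtain ⟨t, ht, htl, ht'⟩ := exists_segment hq.1 hi le_rfl
  have h1 := key s hs (by
    intro x hx; obtain ⟨k, -, -, rfl⟩ := hs' x hx; exact Walk.getVert_mem_support _ _)
  have h2 := key t.reverse ht.reverse (by
    intro x hx
    obtain ⟨k, -, -, rfl⟩ := ht' x (by simpa using hx)
    exact Walk.getVert_mem_support _ _)
  rw [Walk.length_reverse] at h2
  omega

/-- A path with both ends on `q`, internally disjoint from `q`: an ear of `q`. -/
structure IsEar {u v a b : V} (q : G.Walk u v) (r : G.Walk a b) : Prop where
  isPath : r.IsPath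
  start_mem : a ∈ q.support
  end_mem : b ∈ q.support
  ne : a ≠ b
  inter : ∀ x ∈ r.support, x ∈ q.support → x = a ∨ x = b

lemma IsEar.reverse {u v a b : V} {q : G.Walk u v} {r : G.Walk a b} (h : IsEar q r) :
    IsEar q r.reverse :=
  ⟨h.isPath.reverse, h.end_mem, h.start_mem, h.ne.symm, fun x hx hx' =>
    (h.inter x (by simpa using hx) hx').symm⟩

lemma IsEar.reverse_left {u v a b : V} {q : G.Walk u v} {r : G.Walk a b} (h : IsEar q r) :
    IsEar q.reverse r :=
  ⟨h.isPath, by simpa using h.start_mem, by simpa using h.end_mem, h.ne, fun x hx hx' =>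
    h.inter x hx (by simpa using hx')⟩

lemma IsLongestPath.reverse {u v : V} {q : G.Walk u v} (hq : IsLongestPath G q) :
    IsLongestPath G q.reverse :=
  ⟨hq.1.reverse, by simpa using hq.2⟩

lemma IsEar.length_add_le {u v : V} {q : G.Walk u v} (hq : IsLongestPath G q) {i j : ℕ}
    (hij : i < j) (hj : j ≤ q.length) {r : G.Walk (q.getVert i) (q.getVert j)}
    (hr : IsEar q r) : r.length + j ≤ q.length + 1 := by
  obtain ⟨s, hs, hsl, hs'⟩ := exists_segment hq.1 (Nat.zero_le i) (by omega : i ≤ q.length)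
  obtain ⟨t, ht, htl, ht'⟩ := exists_segment hq.1 (Nat.succ_le_of_lt hij) hj
  have hrs : (s.append r).IsPath := by
    refine isPath_append_of_inter hs hr.isPath fun x hx hx' => ?_
    obtain ⟨k, -, hk, rfl⟩ := hs' x hx
    rcases hr.inter _ hx' (Walk.getVert_mem_support _ _) with h | h
    · exact h
    · have := getVert_inj hq.1 (by omega) hj h
      omega
  have := hq.2 _ _ ((s.append r).append t.reverse) (by
    refine isPath_append_of_inter hrs ht.reverse fun x hx hx' => ?_
    obtain ⟨k, hk1, hk2, rfl⟩ := ht' x (by simpa using hx')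
    rcases (Walk.mem_support_append_iff _ _).1 hx with hx | hx
    · obtain ⟨k', -, hk', e⟩ := hs' _ hx
      have := getVert_inj hq.1 (by omega) (by omega) e
      omega
    · rcases hr.inter _ hx (Walk.getVert_mem_support _ _) with h | h
      · have := getVert_inj hq.1 (by omega) (by omega) h
        omega
      · exact h)
  simp only [Walk.length_append, Walk.length_reverse] at this
  omega

lemma IsEar.length_le_sub {u v : V} {q : G.Walk u v} (hq : IsLongestPath G q) {i j : ℕ}
    (hij : i < j) (hj : j ≤ q.length) {r : G.Walk (q.getVert i) (q.getVert j)}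
    (hr : IsEar q r) : r.length + i ≤ j := by
  obtain ⟨s, hs, hsl, hs'⟩ := exists_segment hq.1 (Nat.zero_le i) (by omega : i ≤ q.length)
  obtain ⟨t, ht, htl, ht'⟩ := exists_segment hq.1 hj le_rfl
  have hrs : (s.append r).IsPath := by
    refine isPath_append_of_inter hs hr.isPath fun x hx hx' => ?_
    obtain ⟨k, -, hk, rfl⟩ := hs' x hx
    rcases hr.inter _ hx' (Walk.getVert_mem_support _ _) with h | h
    · exact h
    · have := getVert_inj hq.1 (by omega) hj h
      omega
  have := hq.2 _ _ ((s.append r).append t) (by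
    refine isPath_append_of_inter hrs ht fun x hx hx' => ?_
    obtain ⟨k, hk1, hk2, rfl⟩ := ht' x hx'
    rcases (Walk.mem_support_append_iff _ _).1 hx with hx | hx
    · obtain ⟨k', -, hk', e⟩ := hs' _ hx
      have := getVert_inj hq.1 (by omega) (by omega) e
      omega
    · rcases hr.inter _ hx (Walk.getVert_mem_support _ _) with h | h
      · have := getVert_inj hq.1 (by omega) (by omega) h
        omega
      · exact h)
  simp only [Walk.length_append] at this
  omega

/-- An ear of a longest path `q` has length at most `(|q| + 2) / 3`. -/
lemma IsEar.three_mul_length_le {u v a b : V} {q : G.Walk u v} (hq : IsLongestPath G q)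
    {r : G.Walk a b} (hr : IsEar q r) : 3 * r.length ≤ q.length + 2 := by
  obtain ⟨i, rfl, hi⟩ := Walk.mem_support_iff_exists_getVert.1 hr.start_mem
  obtain ⟨j, rfl, hj⟩ := Walk.mem_support_iff_exists_getVert.1 hr.end_mem
  have main : ∀ i j, i < j → j ≤ q.length → ∀ r : G.Walk (q.getVert i) (q.getVert j),
      IsEar q r → 3 * r.length ≤ q.length + 2 := by
    intro i j hij hj r hr
    have h1 := hr.length_add_le hq hij hj
    have h2 := hr.length_le_sub hq hij hj
    have ei : q.reverse.getVert (q.length - i) = q.getVert i := by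
      rw [Walk.getVert_reverse]; congr 1; omega
    have ej : q.reverse.getVert (q.length - j) = q.getVert j := by
      rw [Walk.getVert_reverse]; congr 1; omega
    have hr' : IsEar q.reverse (r.reverse.copy ej.symm ei.symm) := by
      have := hr.reverse.reverse_left
      exact ⟨by simpa using this.isPath, Walk.getVert_mem_support _ _,
        Walk.getVert_mem_support _ _, ej ▸ ei ▸ this.ne,
        fun x hx hx' => by
          rw [ei, ej]; exact this.inter x (by simpa using hx) hx'⟩
    have h3 := hr'.length_add_le hq.reverse (by omega) (by simp)
    simp only [Walk.length_copy, Walk.length_reverse] at h3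
    omega
  rcases lt_trichotomy i j with h | h | h
  · exact main i j h hj r hr
  · exact absurd (h ▸ rfl) hr.ne
  · simpa using main j i h hi r.reverse hr.reverse

lemma IsEar.exists_of_mem_mem {u v a b x y : V} {q : G.Walk u v} {r : G.Walk a b}
    (hr : IsEar q r) {c : G.Walk x y} (hc : c.IsPath) (hx : x ∈ r.support) (hy : y ∈ r.support)
    (hxy : x ≠ y) (h : ∀ z ∈ c.support, z ∈ r.support ∨ z ∈ q.support → z = x ∨ z = y) :
    ∃ (a' b' : V) (r' : G.Walk a' b'), IsEar q r' ∧ ∀ z ∈ c.support, z ∈ r'.support := by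
  have main : ∀ i j, i < j → j ≤ r.length → ∀ c : G.Walk (r.getVert i) (r.getVert j), c.IsPath →
      (∀ z ∈ c.support, z ∈ r.support ∨ z ∈ q.support → z = r.getVert i ∨ z = r.getVert j) →
      ∃ (a' b' : V) (r' : G.Walk a' b'), IsEar q r' ∧ ∀ z ∈ c.support, z ∈ r'.support := by
    intro i j hij hj c hc h
    obtain ⟨s, hs, -, hs'⟩ := exists_segment hr.isPath (Nat.zero_le i) (by omega : i ≤ r.length)
    obtain ⟨t, ht, -, ht'⟩ := exists_segment hr.isPath hj le_rfl
    have hsc : (s.append c).IsPath := by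
      refine isPath_append_of_inter hs hc fun z hz hz' => ?_
      obtain ⟨k, -, hk, rfl⟩ := hs' z hz
      rcases h _ hz' (Or.inl (Walk.getVert_mem_support _ _)) with h | h
      · exact h
      · have := getVert_inj hr.isPath (by omega) hj h
        omega
    refine ⟨_, _, (s.append c).append t, ⟨?_, ?_, ?_, ?_, ?_⟩, ?_⟩
    · refine isPath_append_of_inter hsc ht fun z hz hz' => ?_
      obtain ⟨k, hk1, hk2, rfl⟩ := ht' z hz'
      rcases (Walk.mem_support_append_iff _ _).1 hz with hz | hz
      · obtain ⟨k', -, hk', e⟩ := hs' _ hz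
        have := getVert_inj hr.isPath (by omega) (by omega) e
        omega
      · rcases h _ hz (Or.inl (Walk.getVert_mem_support _ _)) with h | h
        · have := getVert_inj hr.isPath (by omega) (by omega) h
          omega
        · exact h
    · simpa using hr.start_mem
    · simpa using hr.end_mem
    · simpa using hr.ne
    · intro z hz hzq
      have hzr : z ∈ r.support := by
        rcases (Walk.mem_support_append_iff _ _).1 hz with hz | hz
        · rcases (Walk.mem_support_append_iff _ _).1 hz with hz | hz
          · obtain ⟨k, -, -, rfl⟩ := hs' z hz
            exact Walk.getVert_mem_support _ _
          · rcases h z hz (Or.inr hzq) with rfl | rfl <;> exact Walk.getVert_mem_support _ _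
        · obtain ⟨k, -, -, rfl⟩ := ht' z hz
          exact Walk.getVert_mem_support _ _
      simpa using hr.inter z hzr hzq
    · intro z hz
      simp [hz]
  obtain ⟨i, rfl, hi⟩ := Walk.mem_support_iff_exists_getVert.1 hx
  obtain ⟨j, rfl, hj⟩ := Walk.mem_support_iff_exists_getVert.1 hy
  rcases lt_trichotomy i j with hij | hij | hij
  · exact main i j hij hj c hc h
  · exact absurd (hij ▸ rfl) hxy
  · simpa using main j i hij hi c.reverse hc.reverse
      (fun z hz hz' => (h z (by simpa using hz) hz').symm)

lemma IsEar.exists_of_mem_notMem {u v a b x y : V} {q : G.Walk u v} {r : G.Walk a b}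
    (hr : IsEar q r) {c : G.Walk x y} (hc : c.IsPath) (hx : x ∈ r.support) (hy : y ∈ q.support)
    (hyr : y ∉ r.support) (h : ∀ z ∈ c.support, z ∈ r.support ∨ z ∈ q.support → z = x ∨ z = y) :
    ∃ (a' b' : V) (r' : G.Walk a' b'), IsEar q r' ∧ ∀ z ∈ c.support, z ∈ r'.support := by
  by_cases hxq : x ∈ q.support
  · exact ⟨x, y, c, ⟨hc, hxq, hy, fun e => hyr (e ▸ hx), fun z hz hz' => h z hz (Or.inr hz')⟩,
      fun z hz => hz⟩
  obtain ⟨i, rfl, hi⟩ := Walk.mem_support_iff_exists_getVert.1 hx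
  obtain ⟨s, hs, -, hs'⟩ := exists_segment hr.isPath (Nat.zero_le i) hi
  have hsr : ∀ z ∈ s.support, z ∈ r.support := by
    intro z hz
    obtain ⟨k, -, -, rfl⟩ := hs' z hz
    exact Walk.getVert_mem_support _ _
  refine ⟨_, _, s.append c, ⟨?_, ?_, hy, ?_, ?_⟩, ?_⟩
  · refine isPath_append_of_inter hs hc fun z hz hz' => ?_
    rcases h z hz' (Or.inl (hsr z hz)) with h | rfl
    · exact h
    · exact absurd (hsr _ hz) hyr
  · simpa using hr.start_mem
  · rintro rfl
    exact hyr (Walk.getVert_mem_support _ _)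
  · intro z hz hzq
    rcases (Walk.mem_support_append_iff _ _).1 hz with hz | hz
    · rcases hr.inter z (hsr z hz) hzq with e | e
      · exact Or.inl (by simpa using e)
      · obtain ⟨k, -, hk, rfl⟩ := hs' z hz
        have e' : r.getVert k = r.getVert r.length := by simpa using e
        have := getVert_inj hr.isPath (by omega) le_rfl e'
        obtain rfl : k = i := by omega
        exact absurd hzq hxq
    · rcases h z hz (Or.inr hzq) with rfl | rfl
      · exact absurd hzq hxq
      · exact Or.inr rfl
  · intro z hz
    simp [hz]

/-- Every vertex of a nontrivial path `q` lies on an ear of `q`, namely an edge of `q`. -/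
lemma exists_isEar_of_mem_support {u v x : V} {q : G.Walk u v}
    (hpos : 0 < q.length) (hx : x ∈ q.support) :
    ∃ (a b : V) (r : G.Walk a b), IsEar q r ∧ x ∈ r.support := by
  have main : ∀ i, i < q.length → ∃ r : G.Walk (q.getVert i) (q.getVert (i + 1)), IsEar q r := by
    intro i hi
    have hadj := q.adj_getVert_succ hi
    refine ⟨hadj.toWalk, ⟨by simp [hadj.ne], Walk.getVert_mem_support _ _,
      Walk.getVert_mem_support _ _, hadj.ne, fun z hz _ => by simpa using hz⟩⟩
  obtain ⟨i, rfl, hi⟩ := Walk.mem_support_iff_exists_getVert.1 hx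
  rcases hi.lt_or_eq with h | h
  · obtain ⟨r, hr⟩ := main i h
    exact ⟨_, _, r, hr, Walk.start_mem_support _⟩
  · obtain ⟨k, rfl⟩ : ∃ k, i = k + 1 := ⟨i - 1, by omega⟩
    obtain ⟨r, hr⟩ := main k (by omega)
    exact ⟨_, _, r, hr, Walk.end_mem_support _⟩

/-- If no vertex outside `A` separates a vertex of `A` from the path `q`, then some ear of `q`
meets `A`. -/
lemma exists_isEar_mem {u v : V} {q : G.Walk u v} (hpos : 0 < q.length)
    {A : Set V} {z : V} (hz : z ∈ A) (hconn : G.Connected)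
    (hA : ∀ z ∈ A, ∀ x ∉ A, ∃ y ∈ q.support, ∃ w : G.Walk z y, x ∉ w.support) :
    ∃ (a b : V) (r : G.Walk a b), IsEar q r ∧ ∃ z ∈ A, z ∈ r.support := by
  classical
  let Q : ℕ → Prop := fun k => ∃ z ∈ A, ∃ (a b : V) (r : G.Walk a b), IsEar q r ∧
    ∃ x ∈ r.support, ∃ s : G.Walk z x, s.length = k
  have hex : ∃ k, Q k := by
    obtain ⟨a, b, r, hr, hu⟩ := exists_isEar_of_mem_support hpos q.start_mem_support
    obtain ⟨s⟩ := hconn.preconnected z u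
    exact ⟨_, z, hz, a, b, r, hr, u, hu, s, rfl⟩
  obtain ⟨z, hz, a, b, r, hr, x, hx, s, hs⟩ := Nat.find_spec hex
  have hmin : ∀ y ∈ s.support, (∃ (a b : V) (r : G.Walk a b), IsEar q r ∧ y ∈ r.support) →
      y = x := by
    rintro y hy ⟨a', b', r', hr', hy'⟩
    by_contra hne
    exact Nat.find_min hex (hs ▸ Walk.length_takeUntil_lt_length hy hne)
      ⟨z, hz, a', b', r', hr', y, hy', s.takeUntil y hy, rfl⟩
  have hmin' : ∀ y ∈ s.support, y ∈ r.support ∨ y ∈ q.support → y = x := by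
    rintro y hy (hy' | hy')
    · exact hmin y hy ⟨a, b, r, hr, hy'⟩
    · exact hmin y hy (exists_isEar_of_mem_support hpos hy')
  by_cases hxA : x ∈ A
  · exact ⟨a, b, r, hr, x, hxA, hx⟩
  exfalso
  obtain ⟨y₀, hy₀, w, hw⟩ := hA z hz x hxA
  obtain ⟨y, hy, w₁, -, hw₁, hw₁'⟩ :=
    exists_path_to_first_hit w {y | y ∈ r.support ∨ y ∈ q.support} (Or.inr hy₀)
  obtain ⟨t, ht, w₂, hw₂p, hw₂, hw₂'⟩ :=
    exists_path_from_last_hit w₁ {y | y ∈ s.support} s.start_mem_support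
  have hxw₂ : x ∉ w₂.support := fun h => hw (hw₁ _ (hw₂ _ h))
  have htx : t ≠ x := fun h => hxw₂ (h ▸ w₂.start_mem_support)
  have hyx : x ≠ y := fun h => hxw₂ (h ▸ w₂.end_mem_support)
  have hss : ∀ y ∈ (s.dropUntil t ht).bypass.support, y ∈ s.support := fun y hy =>
    s.support_dropUntil_subset_support ht (Walk.support_bypass_subset_support _ hy)
  let c := ((s.dropUntil t ht).bypass.reverse).append w₂
  have hc : c.IsPath := by
    refine isPath_append_of_inter (Walk.bypass_isPath _).reverse hw₂p fun y hy hy' => ?_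
    exact hw₂' y hy' (hss y (by simpa using hy))
  have hcr : ∀ p ∈ c.support, p ∈ r.support ∨ p ∈ q.support → p = x ∨ p = y := by
    intro p hp hp'
    rcases (Walk.mem_support_append_iff _ _).1 hp with hp | hp
    · exact Or.inl (hmin' p (hss p (by simpa using hp)) hp')
    · exact Or.inr (hw₁' p (hw₂ p hp) hp')
  have htc : t ∈ c.support := by simp [c]
  have : ∃ (a' b' : V) (r' : G.Walk a' b'), IsEar q r' ∧ ∀ z ∈ c.support, z ∈ r'.support := by
    by_cases hyr : y ∈ r.support
    · exact hr.exists_of_mem_mem hc hx hyr hyx hcr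
    · exact hr.exists_of_mem_notMem hc hx (hy.resolve_left hyr) hyr hcr
  obtain ⟨a', b', r', hr', hr''⟩ := this
  exact htx (hmin t ht ⟨a', b', r', hr', hr'' t htc⟩)

/-- Any two longest paths of a connected graph share a vertex. -/
lemma IsLongestPath.exists_mem_mem (hG : G.Connected) {u v u' v' : V} {p : G.Walk u v}
    {q : G.Walk u' v'} (hp : IsLongestPath G p) (hq : IsLongestPath G q) :
    ∃ x ∈ p.support, x ∈ q.support := by
  by_contra! hdisj
  obtain ⟨w⟩ := hG.preconnected u' u
  obtain ⟨y, hy, w₁, -, -, hw₁⟩ :=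
    exists_path_from_last_hit w {x | x ∈ q.support} q.start_mem_support
  obtain ⟨z, hz, r, hr, hrw, hr'⟩ :=
    exists_path_to_first_hit w₁ {x | x ∈ p.support} p.start_mem_support
  have hrpos : 0 < r.length := by
    rw [Nat.pos_iff_ne_zero]
    intro h
    exact hdisj z hz (Walk.eq_of_length_eq_zero h ▸ hy)
  have hle := hp.2 _ _ q hq.1
  have key : ∀ {c} (s : G.Walk z c), s.IsPath → (∀ x ∈ s.support, x ∈ p.support) →
      2 * (r.length + s.length) ≤ q.length := by
    intro c s hs hsp
    have := hq.two_mul_length_le_of_tail hy (r := r.append s)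
      (isPath_append_of_inter hr hs fun x hx hx' => hr' x hx (hsp x hx')) (by
        intro x hx hxq
        rcases (Walk.mem_support_append_iff _ _).1 hx with hx | hx
        · exact hw₁ x (hrw x hx) hxq
        · exact absurd hxq (hdisj x (hsp x hx)))
    simpa using this
  obtain ⟨i, rfl, hi⟩ := Walk.mem_support_iff_exists_getVert.1 hz
  obtain ⟨s, hs, hsl, hs'⟩ := exists_segment hp.1 (Nat.zero_le i) hi
  obtain ⟨t, ht, htl, ht'⟩ := exists_segment hp.1 hi le_rfl
  have h1 := key s.reverse hs.reverse (by
    intro x hx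
    obtain ⟨k, -, -, rfl⟩ := hs' x (by simpa using hx)
    exact Walk.getVert_mem_support _ _)
  have h2 := key t ht (by
    intro x hx; obtain ⟨k, -, -, rfl⟩ := ht' x hx; exact Walk.getVert_mem_support _ _)
  rw [Walk.length_reverse] at h1
  omega

lemma IsLongestPath.length_eq {u v u' v' : V} {p : G.Walk u v} {q : G.Walk u' v'}
    (hp : IsLongestPath G p) (hq : IsLongestPath G q) : p.length = q.length :=
  le_antisymm (hq.2 _ _ p hp.1) (hp.2 _ _ q hq.1)

lemma IsLongestPath.exists_getVert_mem_of_le (hG : G.Connected) {u v u' v' : V} {p : G.Walk u v}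
    {q : G.Walk u' v'} (hp : IsLongestPath G p) (hq : IsLongestPath G q) {c : ℕ}
    (hc : p.length ≤ 2 * c + 1) : ∃ l ≤ c, p.getVert l ∈ q.support := by
  classical
  obtain ⟨x, hx, hxq⟩ := hp.exists_mem_mem hG hq
  obtain ⟨i, rfl, hi⟩ := Walk.mem_support_iff_exists_getVert.1 hx
  have hex : ∃ n, p.getVert n ∈ q.support := ⟨i, hxq⟩
  have hle : Nat.find hex ≤ p.length := (Nat.find_le hxq).trans hi
  obtain ⟨s, hs, hsl, hs'⟩ := exists_segment hp.1 (Nat.zero_le _) hle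
  have := hq.two_mul_length_le_of_tail (Nat.find_spec hex) hs.reverse (by
    intro x hx hxq
    obtain ⟨k, -, hk, rfl⟩ := hs' x (by simpa using hx)
    rw [le_antisymm hk (Nat.find_le hxq)])
  rw [Walk.length_reverse, ← hp.length_eq hq] at this
  exact ⟨_, by omega, Nat.find_spec hex⟩

/-- Around the middle of a longest path `p`, the vertices of another longest path `q` leave a gap
of length at most `(|p| + 2) / 3`. -/
lemma IsLongestPath.exists_gap (hG : G.Connected) {u v u' v' : V} {p : G.Walk u v}
    {q : G.Walk u' v'} (hp : IsLongestPath G p) (hq : IsLongestPath G q) {c : ℕ}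
    (hc : 2 * c ≤ p.length) (hc' : p.length ≤ 2 * c + 1) :
    ∃ l r, l ≤ c ∧ c ≤ r ∧ r ≤ p.length ∧ p.getVert l ∈ q.support ∧ p.getVert r ∈ q.support ∧
      3 * r ≤ p.length + 2 + 3 * l := by
  classical
  obtain ⟨l₀, hl₀, hl₀q⟩ := hp.exists_getVert_mem_of_le hG hq hc'
  obtain ⟨r₀, hr₀, hr₀q⟩ := hp.reverse.exists_getVert_mem_of_le hG hq
    (c := c) (by simpa using hc')
  rw [Walk.getVert_reverse] at hr₀q
  have hex : ∃ n, c ≤ n ∧ p.getVert n ∈ q.support := ⟨p.length - r₀, by omega, hr₀q⟩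
  have hr := Nat.find_spec hex
  have hrl : Nat.find hex ≤ p.length :=
    (Nat.find_le (h := hex) ⟨by omega, hr₀q⟩).trans (Nat.sub_le _ _)
  have hl := Nat.findGreatest_spec (P := fun n => p.getVert n ∈ q.support) hl₀ hl₀q
  have hlc := Nat.findGreatest_le (P := fun n => p.getVert n ∈ q.support) c
  have hlmax : ∀ k ≤ c, p.getVert k ∈ q.support →
      k ≤ Nat.findGreatest (fun n => p.getVert n ∈ q.support) c :=
    fun k hk hkq => Nat.le_findGreatest hk hkq
  have hrmin : ∀ k, c ≤ k → p.getVert k ∈ q.support → Nat.find hex ≤ k :=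
    fun k hk hkq => Nat.find_le ⟨hk, hkq⟩
  generalize Nat.findGreatest (fun n => p.getVert n ∈ q.support) c = l at *
  generalize Nat.find hex = r at *
  refine ⟨l, r, hlc, hr.1, hrl, hl, hr.2, ?_⟩
  rcases (hlc.trans hr.1).eq_or_lt with e | hlt
  · omega
  obtain ⟨s, hs, hsl, hs'⟩ := exists_segment hp.1 hlt.le hrl
  have hear : IsEar q s := by
    refine ⟨hs, hl, hr.2, fun e => ?_, fun x hx hxq => ?_⟩
    · exact hlt.ne (getVert_inj hp.1 (by omega) hrl e)
    · obtain ⟨k, hk1, hk2, rfl⟩ := hs' x hx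
      rcases le_total k c with hkc | hkc
      · left; rw [le_antisymm (hlmax k hkc hxq) hk1]
      · right; rw [le_antisymm hk2 (hrmin k hkc hxq)]
  have := hear.three_mul_length_le hq
  rw [hp.length_eq hq]
  omega

lemma distToWalk_le_length {x y u v : V} {p : G.Walk u v} (hy : y ∈ p.support) (w : G.Walk x y) :
    distToWalk G x p ≤ w.length := by
  have h : distToWalk G x p ≤ G.dist x y := Nat.sInf_le ⟨y, hy, rfl⟩
  exact h.trans (dist_le w)

lemma distToWalk_eq_zero {x u v : V} {p : G.Walk u v} (hx : x ∈ p.support) :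
    distToWalk G x p = 0 :=
  Nat.le_zero.1 (distToWalk_le_length hx (Walk.nil : G.Walk x x))

lemma pdf_le {k : ℕ} (P : Fin k → Σ u : V, Σ v : V, G.Walk u v) (x : V) :
    pdf G P ≤ ∑ i, distToWalk G x (P i).2.2 :=
  Nat.sInf_le (show _ ∈ {s : ℕ | ∃ x : V, s = ∑ i, distToWalk G x (P i).2.2} from ⟨x, rfl⟩)

lemma distToWalk_getVert_le {u v u' v' : V} {p : G.Walk u v} (hp : p.IsPath) {q : G.Walk u' v'}
    {i j : ℕ} (hi : i ≤ p.length) (hj : j ≤ p.length) (h : p.getVert j ∈ q.support) :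
    distToWalk G (p.getVert i) q ≤ (i - j) + (j - i) := by
  rcases le_total i j with hij | hij
  · obtain ⟨s, -, hs, -⟩ := exists_segment hp hij hj
    have := distToWalk_le_length h s
    omega
  · obtain ⟨s, -, hs, -⟩ := exists_segment hp hij hi
    have := distToWalk_le_length h s.reverse
    rw [Walk.length_reverse] at this
    omega

/-- A vertex of an ear of `q` is, along the ear, at most half its length away from `q`. -/
lemma IsEar.two_mul_distToWalk_le {u v a b z : V} {q : G.Walk u v} {r : G.Walk a b}
    (hr : IsEar q r) (hz : z ∈ r.support) : 2 * distToWalk G z q ≤ r.length := by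
  obtain ⟨i, rfl, hi⟩ := Walk.mem_support_iff_exists_getVert.1 hz
  have h1 := distToWalk_getVert_le hr.isPath (q := q) hi (Nat.zero_le _)
    (by simpa using hr.start_mem)
  have h2 := distToWalk_getVert_le hr.isPath (q := q) hi le_rfl (by simpa using hr.end_mem)
  omega

/-- Double counting of the incidences between vertices and paths. -/
lemma sum_length_le_mul_card [Fintype V] {k m : ℕ} {P : Fin k → Σ u : V, Σ v : V, G.Walk u v}
    (hP : ∀ i, (P i).2.2.IsPath)
    (h : ∀ x, {i | x ∈ (P i).2.2.support}.ncard ≤ m) :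
    ∑ i, ((P i).2.2.length + 1) ≤ m * Fintype.card V := by
  classical
  calc ∑ i, ((P i).2.2.length + 1)
      = ∑ i, ∑ x : V, if x ∈ (P i).2.2.support then 1 else 0 := by
        refine Finset.sum_congr rfl fun i _ => ?_
        rw [← Walk.length_support, ← List.toFinset_card_of_nodup (hP i).support_nodup,
          ← Finset.sum_filter, Finset.card_eq_sum_ones]
        congr 1
        ext x
        simp
    _ = ∑ x : V, ∑ i, if x ∈ (P i).2.2.support then 1 else 0 := Finset.sum_comm
    _ ≤ ∑ _x : V, m := by
        refine Finset.sum_le_sum fun x _ => ?_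
        rw [← Finset.sum_filter, ← Finset.card_eq_sum_ones]
        refine le_trans (le_of_eq ?_) (h x)
        rw [Set.ncard_eq_toFinset_card']
        congr 1
        ext i
        simp
    _ = m * Fintype.card V := by simp [mul_comm]

/-- Three intervals around a common point, each of length at most `(n + 2) / 3` and with distinct
left ends: one of their ends is close to the ends of the two other intervals. -/
lemma eight_mul_le_of_gaps {n f c : ℕ} {l r : Fin 3 → ℕ} {d : ℕ → Fin 3 → ℕ}
    (hl : ∀ j, l j ≤ c) (hr : ∀ j, c ≤ r j) (hrn : ∀ j, r j ≤ n)
    (hgap : ∀ j, 3 * r j ≤ n + 2 + 3 * l j) (hinj : Function.Injective l)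
    (hdl : ∀ x ≤ n, ∀ j, d x j ≤ (x - l j) + (l j - x))
    (hdr : ∀ x ≤ n, ∀ j, d x j ≤ (x - r j) + (r j - x))
    (hf : ∀ x ≤ n, f ≤ ∑ j, d x j) : 8 * f ≤ 3 * n + 1 := by
  have hsum : ∀ i j k : Fin 3, i ≠ j → i ≠ k → j ≠ k → ∀ x ≤ n, f ≤ d x i + d x j + d x k := by
    intro i j k hij hik hjk x hx
    have := hf x hx
    rw [Fin.sum_univ_three] at this
    fin_cases i <;> fin_cases j <;> fin_cases k <;> simp at hij hik hjk ⊢ <;> omega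
  obtain ⟨i, hi⟩ := Finite.exists_max l
  obtain ⟨k, hk⟩ := Finite.exists_min r
  have hli := (hl i).trans ((hr i).trans (hrn i))
  by_cases hik : i = k
  · subst hik
    obtain ⟨j, m, hij, him, hjm⟩ : ∃ j m, i ≠ j ∧ i ≠ m ∧ j ≠ m := by
      clear * -; revert i; decide
    have h := hsum i j m hij him hjm (l i) hli
    have := hdl (l i) hli i
    have := hdl (l i) hli j
    have := hdr (l i) hli j
    have := hdl (l i) hli m
    have := hdr (l i) hli m
    have := hinj.ne hjm
    have := hl i; have := hr j; have := hr m; have := hi j; have := hi m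
    have := hgap j; have := hgap m
    omega
  · obtain ⟨j, hij, hkj⟩ : ∃ j, i ≠ j ∧ k ≠ j := by
      clear * - hik; revert i k; decide
    have h1 := hsum i j k hij hik hkj.symm (l i) hli
    have h2 := hsum i j k hij hik hkj.symm (r k) (hrn k)
    have := hdl (l i) hli i
    have := hdr (l i) hli k
    have := hdl (l i) hli j
    have := hdr (r k) (hrn k) k
    have := hdl (r k) (hrn k) i
    have := hdr (r k) (hrn k) j
    have := hinj.ne hik
    have := hl i; have := hr k; have := hi j; have := hk j; have := hi k; have := hk i
    have := hgap j; have := hgap k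
    omega

/-- If some vertex lies on all but one of the longest paths, then `6 f ≤ ℓ + 2`. -/
lemma six_mul_pdf_le {k : ℕ} (hG : G.Connected) {P : Fin k → Σ u : V, Σ v : V, G.Walk u v}
    (hlong : ∀ i, IsLongestPath G (P i).2.2) {i : Fin k} {v : V}
    (hpos : 0 < (P i).2.2.length) (hv : ∀ j ≠ i, v ∈ (P j).2.2.support) :
    6 * pdf G P ≤ (P i).2.2.length + 2 := by
  have hbound : ∀ z, (∀ j ≠ i, z ∈ (P j).2.2.support) → pdf G P ≤ distToWalk G z (P i).2.2 := by
    intro z hz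
    refine (pdf_le P z).trans (le_of_eq ?_)
    exact Finset.sum_eq_single i (fun j _ hj => distToWalk_eq_zero (hz j hj)) (by simp)
  obtain ⟨a, b, r, hr, z, hz, hzr⟩ := exists_isEar_mem (q := (P i).2.2) hpos
    (A := {z | ∀ j ≠ i, z ∈ (P j).2.2.support}) hv hG (by
      classical
      intro z hz x hx
      simp only [Set.mem_ofPred_eq, not_forall] at hx
      obtain ⟨j, hj, hxj⟩ := hx
      obtain ⟨y, hy, hyi⟩ := (hlong j).exists_mem_mem hG (hlong i)
      refine ⟨y, hyi, ((P j).2.2.takeUntil z (hz j hj)).reverse.append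
        ((P j).2.2.takeUntil y hy), fun h => hxj ?_⟩
      rcases (Walk.mem_support_append_iff _ _).1 h with h | h
      · exact Walk.support_takeUntil_subset_support _ _ (by simpa using h)
      · exact Walk.support_takeUntil_subset_support _ _ h)
  have h1 := hbound z hz
  have h2 := hr.two_mul_distToWalk_le hzr
  have h3 := hr.three_mul_length_le (hlong i)
  omega

/-- If no vertex lies on three of the four longest paths, then `8 f ≤ 3 ℓ + 1`. -/
lemma eight_mul_pdf_le (hG : G.Connected) {P : Fin 4 → Σ u : V, Σ v : V, G.Walk u v}
    (hlong : ∀ i, IsLongestPath G (P i).2.2)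
    (hT : ∀ v, ∀ i j : Fin 3, i ≠ j → v ∈ (P 0).2.2.support → v ∈ (P i.succ).2.2.support →
      v ∉ (P j.succ).2.2.support) :
    8 * pdf G P ≤ 3 * (P 0).2.2.length + 1 := by
  choose l r hl hr hrn hlq hrq hgap using fun j : Fin 3 =>
    (hlong 0).exists_gap hG (hlong j.succ) (c := (P 0).2.2.length / 2) (by omega) (by omega)
  refine eight_mul_le_of_gaps (d := fun x j => distToWalk G ((P 0).2.2.getVert x) (P j.succ).2.2)
    hl hr hrn hgap ?_ ?_ ?_ ?_
  · intro i j hij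
    by_contra hne
    exact hT _ i j hne (Walk.getVert_mem_support _ (l i)) (hlq i) (hij ▸ hlq j)
  · intro x hx j
    exact distToWalk_getVert_le (hlong 0).1 hx ((hl j).trans ((hr j).trans (hrn j))) (hlq j)
  · intro x hx j
    exact distToWalk_getVert_le (hlong 0).1 hx (hrn j) (hrq j)
  · intro x hx
    refine (pdf_le P ((P 0).2.2.getVert x)).trans ?_
    rw [Fin.sum_univ_succ, distToWalk_eq_zero (Walk.getVert_mem_support _ _), zero_add]

lemma two_le_card_of_injective [Fintype V] {k : ℕ} (hk : 2 ≤ k) (hG : G.Connected)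
    {P : Fin k → Σ u : V, Σ v : V, G.Walk u v} (hinj : Function.Injective P) :
    2 ≤ Fintype.card V := by
  by_contra! hcard
  have : Subsingleton V := Fintype.card_le_one_iff_subsingleton.1 (by omega)
  obtain ⟨x⟩ := hG.nonempty
  have hnil : ∀ s : Σ u : V, Σ v : V, G.Walk u v, s = ⟨x, x, Walk.nil⟩ := by
    rintro ⟨u, v, w⟩
    cases w with
    | nil => obtain rfl := Subsingleton.elim u x; rfl
    | cons h _ => exact absurd (Subsingleton.elim _ _) h.ne
  have h01 : (⟨0, by omega⟩ : Fin k) = ⟨1, by omega⟩ := hinj ((hnil _).trans (hnil _).symm)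
  simp at h01

lemma IsLongestPath.length_pos [Fintype V] (hG : G.Connected) (hV : 2 ≤ Fintype.card V) {u v : V}
    {p : G.Walk u v} (hp : IsLongestPath G p) : 0 < p.length := by
  classical
  obtain ⟨x, y, hxy⟩ := Fintype.exists_pair_of_one_lt_card (α := V) (by omega)
  obtain ⟨w⟩ := hG.preconnected x y
  have h := hp.2 _ _ w.bypass w.bypass_isPath
  by_contra! h0
  exact hxy (Walk.eq_of_length_eq_zero (p := w.bypass) (by omega))

end LongestPaths

/-- Theorem 2 (4 longest paths): `f(G,𝒫) ≤ (3n - 4)/16`, i.e. `16·f(G,𝒫) + 4 ≤ 3n`;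
in particular `16·f(G,𝒫) ≤ 3n`. -/
theorem four_longest_paths_bound {V : Type*} [Fintype V] (G : SimpleGraph V)
    (hG : G.Connected) (P : Fin 4 → Σ u : V, Σ v : V, G.Walk u v)
    (hinj : Function.Injective P) (hlong : ∀ i, IsLongestPath G (P i).2.2) :
    16 * pdf G P + 4 ≤ 3 * Fintype.card V ∧ 16 * pdf G P ≤ 3 * Fintype.card V := by
  suffices 16 * pdf G P + 4 ≤ 3 * Fintype.card V from ⟨this, by omega⟩
  have hcard := two_le_card_of_injective (by norm_num) hG hinj
  by_cases hf : pdf G P = 0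
  · omega
  have hlen : ∀ i, (P i).2.2.length = (P 0).2.2.length := fun i => (hlong i).length_eq (hlong 0)
  have hcount : ∀ m, (∀ x, {i | x ∈ (P i).2.2.support}.ncard ≤ m) →
      4 * ((P 0).2.2.length + 1) ≤ m * Fintype.card V := by
    intro m hm
    simpa [hlen] using sum_length_le_mul_card (fun i => (hlong i).1) hm
  by_cases htriple : ∃ i v, ∀ j ≠ i, v ∈ (P j).2.2.support
  · obtain ⟨i, v, hv⟩ := htriple
    have h6 := six_mul_pdf_le hG hlong ((hlong i).length_pos hG hcard) hv
    have h3 := hcount 3 fun x => by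
      obtain ⟨j, hj⟩ : ∃ j, x ∉ (P j).2.2.support := by
        by_contra! hall
        exact hf (Nat.le_zero.1 ((pdf_le P x).trans
          (Finset.sum_eq_zero fun j _ => distToWalk_eq_zero (hall j)).le))
      calc {i | x ∈ (P i).2.2.support}.ncard ≤ ({j}ᶜ : Set (Fin 4)).ncard :=
            Set.ncard_le_ncard fun i hi hij => hj (hij ▸ hi)
        _ = 3 := by rw [Set.ncard_compl]; simp
    rw [hlen] at h6
    omega
  · have hT : ∀ v, ∀ a b c : Fin 4, a ≠ b → a ≠ c → b ≠ c → v ∈ (P a).2.2.support →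
        v ∈ (P b).2.2.support → v ∉ (P c).2.2.support := by
      intro v a b c hab hac hbc ha hb hc
      obtain ⟨i, hi⟩ : ∃ i, ∀ j ≠ i, j = a ∨ j = b ∨ j = c := by
        clear * - hab hac hbc; revert a b c; decide
      refine htriple ⟨i, v, fun j hj => ?_⟩
      rcases hi j hj with rfl | rfl | rfl <;> assumption
    have h8 := eight_mul_pdf_le hG hlong fun v i j hij => hT v 0 i.succ j.succ
      (Fin.succ_ne_zero i).symm (Fin.succ_ne_zero j).symm (by simpa using hij)
    have h2 := hcount 2 fun x => by
      by_contra! h3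
      obtain ⟨a, b, c, ha, hb, hc, hab, hac, hbc⟩ := (Set.two_lt_ncard_iff).1 h3
      exact hT x a b c hab hac hbc ha hb hc
    omega
end

section
/- Let k ≥ 3 be an integer, let G be a connected finite graph on n vertices, and let P be a set of exactly k longest paths of G. Then (6k² - 8k)·f(G,P) ≤ (k³ - 4k² + 5k - 2)·n. -/
open SimpleGraph

section LongestPaths

variable {V : Type*}

/-- `f 0, …, f m` are distinct vertices, consecutive ones being adjacent in `G`. -/
def IsPathFun (G : SimpleGraph V) (m : ℕ) (f : ℕ → V) : Prop :=
  (∀ i ≤ m, ∀ j ≤ m, f i = f j → i = j) ∧ ∀ i < m, G.Adj (f i) (f (i + 1))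

theorem exists_walk_of_adj_succ (G : SimpleGraph V) (m : ℕ) :
    ∀ f : ℕ → V, (∀ i < m, G.Adj (f i) (f (i + 1))) →
      ∃ w : G.Walk (f 0) (f m), w.length = m ∧ ∀ i ≤ m, w.getVert i = f i := by
  induction m with
  | zero => intro f _; exact ⟨Walk.nil, rfl, fun i hi => by simp [Nat.le_zero.1 hi]⟩
  | succ m ih =>
    intro f hf
    obtain ⟨w, hw, hv⟩ := ih (fun i => f (i + 1)) (fun i hi => hf (i + 1) (by omega))
    refine ⟨Walk.cons (hf 0 (by omega)) w, by simp [hw], fun i hi => ?_⟩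
    cases i with
    | zero => simp
    | succ i => simpa using hv i (by omega)

namespace IsPathFun

variable {G : SimpleGraph V} {m m' : ℕ} {f g : ℕ → V}

theorem exists_isPath (h : IsPathFun G m f) :
    ∃ w : G.Walk (f 0) (f m), w.IsPath ∧ w.length = m := by
  obtain ⟨w, hw, hv⟩ := exists_walk_of_adj_succ G m f h.2
  refine ⟨w, (Walk.IsPath.getVert_injOn_iff w).1 fun i hi j hj hij => ?_, hw⟩
  simp only [Set.mem_ofPred_eq, hw] at hi hj
  rw [hv i hi, hv j hj] at hij
  exact h.1 i hi j hj hij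

theorem take (h : IsPathFun G m f) {s : ℕ} (hs : s ≤ m) : IsPathFun G s f :=
  ⟨fun i hi j hj => h.1 i (by omega) j (by omega), fun i hi => h.2 i (by omega)⟩

theorem drop (h : IsPathFun G m f) {s : ℕ} (hs : s ≤ m) :
    IsPathFun G (m - s) (fun i => f (s + i)) :=
  ⟨fun i hi j hj e => by have := h.1 _ (by omega) _ (by omega) e; omega,
    fun i hi => h.2 (s + i) (by omega)⟩

theorem reverse (h : IsPathFun G m f) : IsPathFun G m (fun i => f (m - i)) := by
  refine ⟨fun i hi j hj e => ?_, fun i hi => ?_⟩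
  · have := h.1 _ (by omega) _ (by omega) e
    omega
  · have := h.2 (m - (i + 1)) (by omega)
    rw [show m - (i + 1) + 1 = m - i by omega] at this
    exact this.symm

theorem append (hf : IsPathFun G m f) (hg : IsPathFun G m' g) (e : f m = g 0)
    (hd : ∀ i ≤ m, ∀ j ≤ m', f i = g j → j = 0) :
    IsPathFun G (m + m') (fun t => if t ≤ m then f t else g (t - m)) := by
  refine ⟨fun i hi j hj h => ?_, fun i hi => ?_⟩
  · simp only at h
    split_ifs at h with h1 h2 h2
    · exact hf.1 i h1 j h2 h
    · have := hd i h1 (j - m) (by omega) h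
      omega
    · have := hd j h2 (i - m) (by omega) h.symm
      omega
    · have := hg.1 _ (by omega) _ (by omega) h
      omega
  · simp only
    split_ifs with h1 h2 h2
    · exact hf.2 i (by omega)
    · obtain rfl : i = m := by omega
      rw [e, show i + 1 - i = 0 + 1 by omega]
      exact hg.2 0 (by omega)
    · omega
    · rw [show i + 1 - m = (i - m) + 1 by omega]
      exact hg.2 (i - m) (by omega)

/-- Some path of length at least half that of `f` starts at `f s` and stays inside `f`. -/
theorem exists_half (h : IsPathFun G m f) {s : ℕ} (hs : s ≤ m) :
    ∃ n g, IsPathFun G n g ∧ m ≤ 2 * n ∧ g 0 = f s ∧ ∀ i ≤ n, ∃ j ≤ m, g i = f j := by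
  by_cases hh : m ≤ 2 * s
  · exact ⟨s, _, (h.take hs).reverse, hh, by simp, fun i hi => ⟨s - i, by omega, rfl⟩⟩
  · exact ⟨m - s, _, h.drop hs, by omega, by simp, fun i hi => ⟨s + i, by omega, rfl⟩⟩

/-- In a connected graph, a shortest link between two vertex sets. -/
theorem exists_link (hG : G.Connected) (A B : V → Prop) {a b : V} (ha : A a) (hb : B b) :
    ∃ n g, IsPathFun G n g ∧ A (g 0) ∧ B (g n) ∧ (∀ i ≤ n, A (g i) → i = 0) ∧
      ∀ i ≤ n, B (g i) → i = n := by
  classical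
  have hex : ∃ n, ∃ g, IsPathFun G n g ∧ A (g 0) ∧ B (g n) := by
    obtain ⟨w, hw⟩ := hG.exists_isPath a b
    exact ⟨w.length, w.getVert,
      ⟨fun i hi j hj e => hw.getVert_injOn hi hj e, fun i hi => w.adj_getVert_succ hi⟩,
      by simpa using ha, by simpa using hb⟩
  obtain ⟨g, hg, h0, hn⟩ := Nat.find_spec hex
  refine ⟨Nat.find hex, g, hg, h0, hn, fun i hi hA => ?_, fun i hi hB => ?_⟩
  · by_contra hne
    refine Nat.find_min hex (m := Nat.find hex - i) (by omega) ⟨_, hg.drop hi, by simpa using hA, ?_⟩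
    simpa [Nat.add_sub_cancel' hi] using hn
  · by_contra hne
    exact Nat.find_min hex (m := i) (by omega) ⟨g, hg.take hi, h0, hB⟩

end IsPathFun

/-- How a longest path `p` of length `ℓ` meets another longest path `q`. -/
structure IsLongestPair (ℓ : ℕ) (p q : ℕ → V) : Prop where
  inj : ∀ i ≤ ℓ, ∀ j ≤ ℓ, p i = p j → i = j
  inter : ∃ a ≤ ℓ, ∃ b ≤ ℓ, p a = q b
  first : ∀ a ≤ ℓ, ∀ b ≤ ℓ, p a = q b → (∀ a' < a, ∀ b' ≤ ℓ, p a' ≠ q b') → a ≤ b ∧ a + b ≤ ℓ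
  last : ∀ a ≤ ℓ, ∀ b ≤ ℓ, p a = q b → (∀ a' ≤ ℓ, a < a' → ∀ b' ≤ ℓ, p a' ≠ q b') →
    ℓ ≤ a + b ∧ b ≤ a
  start : ∀ b ≤ ℓ, p 0 = q b → (b + 1 ≤ ℓ → ∃ a ≤ ℓ, p a = q (b + 1)) ∧
    (1 ≤ b → ∃ a ≤ ℓ, p a = q (b - 1))

section Longest

variable {G : SimpleGraph V} {ℓ : ℕ} {p q : ℕ → V}

theorem IsPathFun.first_le (hmax : ∀ m f, IsPathFun G m f → m ≤ ℓ) (hp : IsPathFun G ℓ p)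
    (hq : IsPathFun G ℓ q) {a b : ℕ} (ha : a ≤ ℓ) (hb : b ≤ ℓ) (e : p a = q b)
    (hf : ∀ a' < a, ∀ b' ≤ ℓ, p a' ≠ q b') : a ≤ b ∧ a + b ≤ ℓ := by
  have key : ∀ q' : ℕ → V, IsPathFun G ℓ q' → ∀ b' ≤ ℓ, p a = q' b' →
      (∀ i ≤ ℓ, ∃ j ≤ ℓ, q' i = q j) → a ≤ b' := by
    intro q' hq' b' hb' e' hsub
    have := hmax _ _ ((hp.take ha).append (hq'.drop hb') (by simpa using e') ?_)
    · omega
    · intro i hi j hj hij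
      obtain ⟨c, hc, hqc⟩ := hsub (b' + j) (by omega)
      have : i = a := by
        by_contra hne
        exact hf i (by omega) c hc (hij.trans hqc)
      subst this
      have := hq'.1 _ hb' _ (by omega) (e'.symm.trans hij)
      omega
  refine ⟨key q hq b hb e fun i hi => ⟨i, hi, rfl⟩, ?_⟩
  have := key _ hq.reverse (ℓ - b) (by omega) (by simpa [Nat.sub_sub_self hb] using e)
    fun i hi => ⟨ℓ - i, by omega, rfl⟩
  omega

theorem IsPathFun.isLongestPair (hG : G.Connected) (hmax : ∀ m f, IsPathFun G m f → m ≤ ℓ)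
    (hp : IsPathFun G ℓ p) (hq : IsPathFun G ℓ q) : IsLongestPair ℓ p q where
  inj := hp.1
  first a ha b hb e hf := hp.first_le hmax hq ha hb e hf
  last a ha b hb e hf := by
    have := hp.reverse.first_le (a := ℓ - a) hmax hq (by omega) hb
      (by simpa [Nat.sub_sub_self ha] using e)
      fun a' ha' b' hb' => hf (ℓ - a') (by omega) (by omega) b' hb'
    omega
  inter := by
    by_contra! hd
    obtain ⟨n, g, hg, ⟨a, ha, hga⟩, ⟨b, hb, hgb⟩, hA, hB⟩ :=
      IsPathFun.exists_link hG (fun v => ∃ a ≤ ℓ, p a = v) (fun v => ∃ b ≤ ℓ, q b = v)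
        ⟨0, by omega, rfl⟩ ⟨0, by omega, rfl⟩
    obtain ⟨m₁, h₁, hh₁, hm₁, h₁0, hs₁⟩ := hp.exists_half ha
    obtain ⟨m₂, h₂, hh₂, hm₂, h₂0, hs₂⟩ := hq.exists_half hb
    have hn : n ≠ 0 := by
      rintro rfl
      exact hd a ha b hb (hga.trans hgb.symm)
    have h12 := hh₁.reverse.append hg (by simp [h₁0, hga]) (fun i hi j hj hij => by
      obtain ⟨c, hc, hpc⟩ := hs₁ (m₁ - i) (by omega)
      exact hA j hj ⟨c, hc, by rw [← hpc, hij]⟩)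
    have h123 := h12.append hh₂ (by
        simp only [h₂0, hgb]
        rw [if_neg (by omega), Nat.add_sub_cancel_left]) (fun i hi j hj hij => by
      obtain ⟨d, hd', hqd⟩ := hs₂ j hj
      split_ifs at hij with hi1
      · obtain ⟨c, hc, hpc⟩ := hs₁ (m₁ - i) (by omega)
        exact absurd (hpc.symm.trans (hij.trans hqd)) (hd c hc d hd')
      · have := hB (i - m₁) (by omega) ⟨d, hd', by rw [← hqd, hij]⟩
        rw [this, ← hgb, ← h₂0] at hij
        exact (hh₂.1 _ (by omega) _ hj hij).symm)
    have := hmax _ _ h123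
    omega
  start b hb e := by
    have key : ∀ v, G.Adj v (p 0) → ∃ a ≤ ℓ, p a = v := by
      intro v hv
      by_contra! hn
      have h0 : IsPathFun G 1 (fun i => if i = 0 then v else p 0) := by
        refine ⟨fun i hi j hj h => ?_, fun i hi => ?_⟩
        · simp only at h
          split_ifs at h with h1 h2 h2
          · omega
          · exact absurd h hv.ne
          · exact absurd h hv.ne'
          · omega
        · obtain rfl : i = 0 := by omega
          simpa using hv
      have := hmax _ _ (h0.append hp (by simp) fun i hi j hj h => by
        split_ifs at h with h1
        · exact absurd h.symm (hn j hj)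
        · exact (hp.1 _ (by omega) _ hj h).symm)
      omega
    refine ⟨fun hb' => key _ ?_, fun hb' => key _ ?_⟩
    · rw [e]
      exact (hq.2 b (by omega)).symm
    · rw [e]
      have := hq.2 (b - 1) (by omega)
      rwa [Nat.sub_add_cancel hb'] at this

end Longest

section Positions

theorem two_mul_sum_range_succ (n : ℕ) : 2 * ∑ i ∈ Finset.range n, (i + 1) = n * (n + 1) := by
  induction n with
  | zero => simp
  | succ n ih => rw [Finset.sum_range_succ, mul_add, ih]; ring

theorem two_mul_sum_range_sub (n : ℕ) : 2 * ∑ i ∈ Finset.range n, (n - i) = n * (n + 1) := by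
  rw [← two_mul_sum_range_succ, ← Finset.sum_range_reflect]
  congr 1
  refine Finset.sum_congr rfl fun i hi => ?_
  have := Finset.mem_range.1 hi
  omega

/-- Sum of distances to a set of positions, between two of its members. -/
theorem four_mul_sum_Ico_le {I : ℕ → Prop} [DecidablePred I] {d : ℕ → ℕ} {a b : ℕ}
    (ha : I a) (hb : I b) (hab : a ≤ b)
    (hd : ∀ i, a ≤ i → i ≤ b → ∀ x, a ≤ x → x ≤ b → I x → d i ≤ (x - i) + (i - x)) :
    4 * ∑ i ∈ Finset.Ico a (b + 1), d i ≤
      (b - a + 2) * ((Finset.Ico a (b + 1)).filter fun i => ¬ I i).card := by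
  set S := Finset.Ico a (b + 1)
  set M := S.filter fun i => ¬ I i
  have hball : ∀ i ∈ S, 2 * d i ≤ (M.filter fun j => (j - i) + (i - j) < d i).card +
      (if ¬ I i then 1 else 0) := by
    intro i hi
    simp only [S, Finset.mem_Ico] at hi
    by_cases hI : I i
    · have := hd i hi.1 (by omega) i hi.1 (by omega) hI
      simp [hI]; omega
    · have h1 := hd i hi.1 (by omega) a le_rfl hab ha
      have h2 := hd i hi.1 (by omega) b hab le_rfl hb
      have hsub : Finset.Ico (i + 1 - d i) (i + d i) ⊆
          M.filter fun j => (j - i) + (i - j) < d i := by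
        intro j hj
        rw [Finset.mem_Ico] at hj
        simp only [M, S, Finset.mem_filter, Finset.mem_Ico]
        refine ⟨⟨by omega, fun hIj => ?_⟩, by omega⟩
        have := hd i hi.1 (by omega) j (by omega) (by omega) hIj
        omega
      have := Finset.card_le_card hsub
      rw [Nat.card_Ico] at this
      simp only [hI, not_false_eq_true, if_true]
      omega
  have hcol : ∀ j ∈ M, 2 * (S.filter fun i => (j - i) + (i - j) < d i).card ≤ b - a := by
    intro j hj
    simp only [M, S, Finset.mem_filter, Finset.mem_Ico] at hj
    have hsub : (S.filter fun i => (j - i) + (i - j) < d i) ⊆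
        Finset.Ico ((a + j) / 2 + 1) ((b + j + 1) / 2) := by
      intro i hi
      simp only [S, Finset.mem_filter, Finset.mem_Ico] at hi
      have h1 := hd i hi.1.1 (by omega) a le_rfl hab ha
      have h2 := hd i hi.1.1 (by omega) b hab le_rfl hb
      rw [Finset.mem_Ico]
      omega
    have := Finset.card_le_card hsub
    rw [Nat.card_Ico] at this
    omega
  have hswap : ∑ i ∈ S, (M.filter fun j => (j - i) + (i - j) < d i).card =
      ∑ j ∈ M, (S.filter fun i => (j - i) + (i - j) < d i).card := by
    simp only [Finset.card_filter]
    exact Finset.sum_comm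
  have h1 := Finset.sum_le_sum hball
  rw [Finset.sum_add_distrib, hswap, ← Finset.mul_sum, ← Finset.card_filter] at h1
  have h2 := Finset.sum_le_sum hcol
  rw [← Finset.mul_sum, Finset.sum_const, smul_eq_mul] at h2
  change _ ≤ _ + M.card at h1
  nlinarith

theorem four_mul_sum_le {I : ℕ → Prop} [DecidablePred I] {d : ℕ → ℕ} {ℓ a b : ℕ}
    (ha : I a) (hb : I b) (hal : 2 * a ≤ ℓ) (hbl : ℓ ≤ 2 * b) (hbℓ : b ≤ ℓ)
    (hlo : ∀ i < a, ¬ I i) (hhi : ∀ i ≤ ℓ, b < i → ¬ I i)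
    (hd : ∀ i ≤ ℓ, ∀ x ≤ ℓ, I x → d i ≤ (x - i) + (i - x)) :
    4 * ∑ i ∈ Finset.range (ℓ + 1), d i ≤
      (ℓ + 2) * ((Finset.range (ℓ + 1)).filter fun i => ¬ I i).card := by
  have hmid := four_mul_sum_Ico_le ha hb (by omega)
    fun i _ hi x _ hx => hd i (by omega) x (by omega)
  have hleft : 2 * ∑ i ∈ Finset.range a, d i ≤ a * (a + 1) := by
    rw [← two_mul_sum_range_sub]
    refine Nat.mul_le_mul_left _ (Finset.sum_le_sum fun i hi => ?_)
    rw [Finset.mem_range] at hi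
    have := hd i (by omega) a (by omega) ha
    omega
  have hright : 2 * ∑ i ∈ Finset.Ico (b + 1) (ℓ + 1), d i ≤ (ℓ - b) * (ℓ - b + 1) := by
    rw [← two_mul_sum_range_succ, Finset.sum_Ico_eq_sum_range,
      show ℓ + 1 - (b + 1) = ℓ - b by omega]
    refine Nat.mul_le_mul_left _ (Finset.sum_le_sum fun i hi => ?_)
    rw [Finset.mem_range] at hi
    have := hd (b + 1 + i) (by omega) b (by omega) hb
    omega
  rw [Finset.card_filter, Finset.range_eq_Ico,
    ← Finset.sum_Ico_consecutive _ (Nat.zero_le a) (show a ≤ ℓ + 1 by omega),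
    ← Finset.sum_Ico_consecutive _ (show a ≤ b + 1 by omega) (show b + 1 ≤ ℓ + 1 by omega),
    ← Finset.sum_Ico_consecutive _ (Nat.zero_le a) (show a ≤ ℓ + 1 by omega),
    ← Finset.sum_Ico_consecutive _ (show a ≤ b + 1 by omega) (show b + 1 ≤ ℓ + 1 by omega),
    ← Finset.card_filter, ← Finset.card_filter, ← Finset.card_filter,
    Finset.filter_true_of_mem (s := Finset.Ico 0 a) (by simpa using hlo),
    Finset.filter_true_of_mem (s := Finset.Ico (b + 1) (ℓ + 1))
      (fun i hi => hhi i (by rw [Finset.mem_Ico] at hi; omega)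
        (by rw [Finset.mem_Ico] at hi; omega)), Nat.card_Ico, Nat.card_Ico,
    ← Finset.range_eq_Ico, show ℓ + 1 - (b + 1) = ℓ - b by omega, Nat.sub_zero]
  have h1 : 2 * (a * (a + 1)) ≤ (ℓ + 2) * a := by nlinarith
  have h2 : 2 * ((ℓ - b) * (ℓ - b + 1)) ≤ (ℓ + 2) * (ℓ - b) := by
    have : 2 * (ℓ - b) ≤ ℓ := by omega
    nlinarith
  have h3 := Nat.mul_le_mul_right
    ((Finset.Ico a (b + 1)).filter fun i => ¬ I i).card (show b - a + 2 ≤ ℓ + 2 by omega)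
  rw [mul_add, mul_add, mul_add, mul_add]
  omega

/-- Between a position in `X` and a position in `Y` at least `f - 1` positions lie in neither,
if members of `X` and of `Y` are at least `f` apart. -/
theorem le_card_filter_Ioo_add_one {X Y : ℕ → Prop} [DecidablePred X] [DecidablePred Y] {f : ℕ} :
    ∀ n x y, y - x ≤ n → x < y → X x → Y y →
      (∀ a b, x ≤ a → a ≤ y → x ≤ b → b ≤ y → X a → Y b → a + f ≤ b ∨ b + f ≤ a) →
      f ≤ ((Finset.Ioo x y).filter fun a => ¬ X a ∧ ¬ Y a).card + 1 := by
  intro n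
  induction n with
  | zero => intro x y h1 h2; omega
  | succ n ih =>
    intro x y hn hxy hX hY hs
    by_cases h : ∃ z, x < z ∧ z < y ∧ (X z ∨ Y z)
    · obtain ⟨z, hz1, hz2, hz | hz⟩ := h
      · refine (ih z y (by omega) hz2 hz hY fun a b _ _ _ _ =>
          hs a b (by omega) (by omega) (by omega) (by omega)).trans ?_
        gcongr
      · refine (ih x z (by omega) hz1 hX hz fun a b _ _ _ _ =>
          hs a b (by omega) (by omega) (by omega) (by omega)).trans ?_
        gcongr
    · push Not at h
      rw [Finset.filter_true_of_mem, Nat.card_Ioo]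
      · have := hs x y le_rfl hxy.le hxy.le le_rfl hX hY
        omega
      · intro a ha
        rw [Finset.mem_Ioo] at ha
        exact h a ha.1 ha.2

end Positions

section PathVerts

variable [DecidableEq V] {ℓ : ℕ} {p q r : ℕ → V}

/-- The vertices `p 0, …, p ℓ`. -/
def pathVerts (ℓ : ℕ) (p : ℕ → V) : Finset V := (Finset.range (ℓ + 1)).image p

theorem mem_pathVerts {v : V} : v ∈ pathVerts ℓ p ↔ ∃ i ≤ ℓ, p i = v := by
  simp [pathVerts]

theorem apply_mem_pathVerts {i : ℕ} (hi : i ≤ ℓ) : p i ∈ pathVerts ℓ p :=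
  mem_pathVerts.2 ⟨i, hi, rfl⟩

namespace IsLongestPair

theorem card_filter (h : IsLongestPair ℓ p q) (A : V → Prop) [DecidablePred A] :
    ((Finset.range (ℓ + 1)).filter fun i => A (p i)).card = ((pathVerts ℓ p).filter A).card := by
  rw [pathVerts, Finset.filter_image, Finset.card_image_of_injOn]
  intro i hi j hj e
  simp only [Finset.coe_filter, Finset.mem_range, Set.mem_ofPred_eq] at hi hj
  exact h.inj i (by omega) j (by omega) e

theorem card_pathVerts (h : IsLongestPair ℓ p q) : (pathVerts ℓ p).card = ℓ + 1 := by
  simpa using (h.card_filter fun _ => True).symm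

theorem exists_first (h : IsLongestPair ℓ p q) :
    ∃ a ≤ ℓ, p a ∈ pathVerts ℓ q ∧ (∀ i < a, p i ∉ pathVerts ℓ q) ∧
      ∃ b ≤ ℓ, p a = q b ∧ a ≤ b ∧ a + b ≤ ℓ := by
  have hex : ∃ a, a ≤ ℓ ∧ p a ∈ pathVerts ℓ q := by
    obtain ⟨a, ha, b, hb, e⟩ := h.inter
    exact ⟨a, ha, mem_pathVerts.2 ⟨b, hb, e.symm⟩⟩
  obtain ⟨ha, hm⟩ := Nat.find_spec hex
  have hmin : ∀ i < Nat.find hex, p i ∉ pathVerts ℓ q := fun i hi hiq =>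
    Nat.find_min hex hi ⟨by omega, hiq⟩
  obtain ⟨b, hb, e⟩ := mem_pathVerts.1 hm
  exact ⟨_, ha, hm, hmin, b, hb, e.symm, h.first _ ha b hb e.symm fun a' ha' b' hb' e' =>
    hmin a' ha' (mem_pathVerts.2 ⟨b', hb', e'.symm⟩)⟩

theorem exists_last (h : IsLongestPair ℓ p q) :
    ∃ a ≤ ℓ, p a ∈ pathVerts ℓ q ∧ (∀ i ≤ ℓ, a < i → p i ∉ pathVerts ℓ q) ∧ ℓ ≤ 2 * a := by
  have hne : ((Finset.range (ℓ + 1)).filter fun i => p i ∈ pathVerts ℓ q).Nonempty := by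
    obtain ⟨a, ha, b, hb, e⟩ := h.inter
    exact ⟨a, by simpa using ⟨by omega, mem_pathVerts.2 ⟨b, hb, e.symm⟩⟩⟩
  obtain ⟨a, ha, hmax⟩ := Finset.exists_max_image _ id hne
  simp only [Finset.mem_filter, Finset.mem_range, id] at ha hmax
  have hmin : ∀ i ≤ ℓ, a < i → p i ∉ pathVerts ℓ q := fun i hi hai hiq => by
    have := hmax i ⟨by omega, hiq⟩
    omega
  obtain ⟨b, hb, e⟩ := mem_pathVerts.1 ha.2
  refine ⟨a, by omega, ha.2, hmin, ?_⟩
  have := h.last a (by omega) b hb e.symm fun a' ha' h' b' hb' e' =>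
    hmin a' ha' h' (mem_pathVerts.2 ⟨b', hb', e'.symm⟩)
  omega

end IsLongestPair

end PathVerts

section Family

variable [DecidableEq V] {ℓ k f : ℕ} {p : Fin k → ℕ → V} {D : Fin k → V → ℕ}

theorem two_le_of_pos (hp : ∀ i j, IsLongestPair ℓ (p i) (p j))
    (hD : ∀ i j, ∀ a ≤ ℓ, ∀ b ≤ ℓ, p i b ∈ pathVerts ℓ (p j) → D j (p i a) ≤ (b - a) + (a - b))
    (hf : ∀ v, f ≤ ∑ j, D j v) (hk : 0 < k) (hpos : 0 < f) : 2 ≤ ℓ := by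
  by_contra hl
  have : ∀ j, D j (p ⟨0, hk⟩ 0) = 0 := by
    intro j
    obtain ⟨a, ha, haj, -, b, -, -, hb⟩ := (hp ⟨0, hk⟩ j).exists_first
    obtain rfl : a = 0 := by omega
    simpa using hD ⟨0, hk⟩ j 0 (by omega) 0 (by omega) haj
  have := hf (p ⟨0, hk⟩ 0)
  simp_all

theorem two_mul_le_of_four_paths {p : Fin 4 → ℕ → V} {D : Fin 4 → V → ℕ}
    (hp : ∀ i j, IsLongestPair ℓ (p i) (p j))
    (hD : ∀ i j, ∀ a ≤ ℓ, ∀ b ≤ ℓ, p i b ∈ pathVerts ℓ (p j) → D j (p i a) ≤ (b - a) + (a - b))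
    (hf : ∀ v, f ≤ ∑ j, D j v) : 2 * f ≤ ℓ := by
  have key : ∀ j, ∃ s, 2 * s ≤ ℓ ∧ p 0 s ∈ pathVerts ℓ (p j) := by
    intro j
    obtain ⟨a, ha, haj, -, b, -, -, hb⟩ := (hp 0 j).exists_first
    exact ⟨a, by omega, haj⟩
  choose s hs hsj using key
  have hd : ∀ a ≤ ℓ, ∀ j, D j (p 0 a) ≤ (s j - a) + (a - s j) := fun a ha j =>
    hD 0 j a ha (s j) (by have := hs j; omega) (hsj j)
  have h0 : ∀ a ≤ ℓ, D 0 (p 0 a) = 0 := fun a ha => by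
    simpa using hD 0 0 a ha a ha (apply_mem_pathVerts ha)
  have h1 := hf (p 0 (s 1))
  have h2 := hf (p 0 (s 2))
  have h3 := hf (p 0 (s 3))
  have l1 := hs 1
  have l2 := hs 2
  have l3 := hs 3
  rw [Fin.sum_univ_four, h0 _ (by omega)] at h1 h2 h3
  have a11 := hd (s 1) (by omega) 1
  have a12 := hd (s 1) (by omega) 2
  have a13 := hd (s 1) (by omega) 3
  have a21 := hd (s 2) (by omega) 1
  have a22 := hd (s 2) (by omega) 2
  have a23 := hd (s 2) (by omega) 3
  have a31 := hd (s 3) (by omega) 1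
  have a32 := hd (s 3) (by omega) 2
  have a33 := hd (s 3) (by omega) 3
  omega

variable [Fintype V]

theorem longestPaths_averaging (hp : ∀ i j, IsLongestPair ℓ (p i) (p j))
    (hD : ∀ i j, ∀ a ≤ ℓ, ∀ b ≤ ℓ, p i b ∈ pathVerts ℓ (p j) → D j (p i a) ≤ (b - a) + (a - b))
    (hf : ∀ v, f ≤ ∑ j, D j v) (hk : 0 < k) :
    k * (ℓ + 1) * (ℓ + 2) + 4 * f * Fintype.card V ≤ Fintype.card V * (k * (ℓ + 2)) := by
  set A := fun i => pathVerts ℓ (p i)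
  have hij : ∀ i j, 4 * ∑ a ∈ Finset.range (ℓ + 1), D j (p i a) +
      (ℓ + 2) * (A i ∩ A j).card ≤ (ℓ + 2) * (ℓ + 1) := by
    intro i j
    obtain ⟨a, ha, haj, hlo, b₁, -, -, hb₁⟩ := (hp i j).exists_first
    obtain ⟨b, hb, hbj, hhi, hbl⟩ := (hp i j).exists_last
    have h1 := four_mul_sum_le (I := fun x => p i x ∈ A j) (d := fun x => D j (p i x)) haj hbj
      (by omega) hbl hb hlo hhi fun x hx y hy => hD i j x hx y hy
    have h2 := (hp i j).card_filter fun v => v ∈ A j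
    rw [Finset.filter_mem_eq_inter] at h2
    have h3 := Finset.card_filter_add_card_filter_not (s := Finset.range (ℓ + 1))
      fun x => p i x ∈ A j
    rw [h2, Finset.card_range] at h3
    have h4 := congrArg ((ℓ + 2) * ·) h3
    simp only [mul_add (ℓ + 2)] at h4
    linarith
  have hi : ∀ i, 4 * (f * (ℓ + 1)) + (ℓ + 2) * ∑ j, (A i ∩ A j).card ≤
      k * ((ℓ + 2) * (ℓ + 1)) := by
    intro i
    have h1 := Finset.sum_le_sum fun j (_ : j ∈ Finset.univ) => hij i j
    rw [Finset.sum_add_distrib, ← Finset.mul_sum, ← Finset.mul_sum, Finset.sum_comm,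
      Finset.sum_const, Finset.card_univ, Fintype.card_fin, smul_eq_mul] at h1
    have h2 := Finset.sum_le_sum fun a (_ : a ∈ Finset.range (ℓ + 1)) => hf (p i a)
    rw [Finset.sum_const, Finset.card_range, smul_eq_mul] at h2
    linarith
  set m : V → ℕ := fun v => ∑ i, if v ∈ A i then 1 else 0
  have hm : ∑ v, m v = k * (ℓ + 1) := by
    rw [Finset.sum_comm]
    simp only [Finset.sum_ite_mem, Finset.univ_inter, Finset.sum_const, smul_eq_mul, mul_one,
      A, fun i => (hp i i).card_pathVerts, Finset.card_univ, Fintype.card_fin]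
  have hm2 : ∑ v, m v ^ 2 = ∑ i, ∑ j, (A i ∩ A j).card := by
    have : ∀ i j, (A i ∩ A j).card =
        ∑ v, (if v ∈ A i then 1 else 0) * (if v ∈ A j then 1 else 0) := by
      intro i j
      rw [show A i ∩ A j = Finset.univ.filter fun v => v ∈ A i ∧ v ∈ A j by ext; simp,
        Finset.card_filter]
      refine Finset.sum_congr rfl fun v _ => ?_
      by_cases h1 : v ∈ A i <;> by_cases h2 : v ∈ A j <;> simp [h1, h2]
    simp only [this, m, sq, Finset.sum_mul_sum]
    rw [Finset.sum_comm]
    exact Finset.sum_congr rfl fun i _ => Finset.sum_comm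
  have hcs : (∑ v, m v) ^ 2 ≤ Fintype.card V * ∑ v, m v ^ 2 := sq_sum_le_card_mul_sum_sq
  rw [hm, hm2] at hcs
  have htot := Finset.sum_le_sum fun i (_ : i ∈ Finset.univ) => hi i
  rw [Finset.sum_add_distrib, ← Finset.mul_sum Finset.univ _ (ℓ + 2), Finset.sum_const,
    Finset.sum_const, Finset.card_univ, Fintype.card_fin, smul_eq_mul, smul_eq_mul] at htot
  set Q := ∑ i, ∑ j, (A i ∩ A j).card
  have h1 := Nat.mul_le_mul_left (Fintype.card V) htot
  have h2 := Nat.mul_le_mul_left (ℓ + 2) hcs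
  have hpos : 0 < k * (ℓ + 1) := by positivity
  refine Nat.le_of_mul_le_mul_left ?_ hpos
  linarith

theorem longestPaths_bound_of_four_le (hp : ∀ i j, IsLongestPair ℓ (p i) (p j))
    (hD : ∀ i j, ∀ a ≤ ℓ, ∀ b ≤ ℓ, p i b ∈ pathVerts ℓ (p j) → D j (p i a) ≤ (b - a) + (a - b))
    (hf : ∀ v, f ≤ ∑ j, D j v) (hk : 4 ≤ k) :
    (6 * (k : ℤ) ^ 2 - 8 * (k : ℤ)) * (f : ℤ) ≤
      ((k : ℤ) ^ 3 - 4 * (k : ℤ) ^ 2 + 5 * (k : ℤ) - 2) * (Fintype.card V : ℤ) := by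
  have havg := longestPaths_averaging hp hD hf (by omega)
  zify at havg
  rw [show (k : ℤ) ^ 3 - 4 * (k : ℤ) ^ 2 + 5 * (k : ℤ) - 2 = (k - 1) ^ 2 * (k - 2) by ring]
  have hkz : (4 : ℤ) ≤ k := by exact_mod_cast hk
  rcases Nat.eq_zero_or_pos f with rfl | hpos
  · have : (0 : ℤ) ≤ (k - 1) ^ 2 * (k - 2) := mul_nonneg (sq_nonneg _) (by linarith)
    simpa using mul_nonneg this (Int.natCast_nonneg (Fintype.card V))
  have hl : (2 : ℤ) ≤ ℓ := by exact_mod_cast two_le_of_pos hp hD hf (by omega) hpos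
  have hfz : (0 : ℤ) < f := by exact_mod_cast hpos
  have hn : (0 : ℤ) ≤ Fintype.card V := by positivity
  rcases hk.eq_or_lt with rfl | hk5
  · have h2f : (2 : ℤ) * f ≤ ℓ := by exact_mod_cast two_mul_le_of_four_paths hp hD hf
    generalize (Fintype.card V : ℤ) = n at *
    generalize (f : ℤ) = F at *
    generalize (ℓ : ℤ) = L at *
    push_cast at *
    have h1 : (L + 1) * (L + 2) ≤ n * (L + 2 - F) := by linarith
    have h2 : 32 * F * (L + 2 - F) ≤ 9 * ((L + 1) * (L + 2)) := by
      nlinarith [sq_nonneg (L + 2 - 2 * F), sq_nonneg (L - 3)]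
    have h3 : 32 * F ≤ 9 * n := by
      refine le_of_mul_le_mul_right (a := L + 2 - F) ?_ (by linarith)
      linarith
    linarith
  · have hk5z : (5 : ℤ) ≤ k := by exact_mod_cast hk5
    generalize (Fintype.card V : ℤ) = n at *
    generalize (f : ℤ) = F at *
    generalize (ℓ : ℤ) = L at *
    generalize (k : ℤ) = K at *
    have h1 : K * (L + 1) * (L + 2) ≤ n * (K * (L + 2) - 4 * F) := by linarith
    have h2 : 16 * F * (K * (L + 2) - 4 * F) ≤ (K * (L + 2)) ^ 2 := by
      nlinarith [sq_nonneg (K * (L + 2) - 8 * F)]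
    have h3 : 16 * F * (L + 1) ≤ n * K * (L + 2) := by
      have hKL : 0 < K * (L + 2) := by nlinarith
      refine le_of_mul_le_mul_right (a := K * (L + 2)) ?_ hKL
      have h4 := mul_le_mul_of_nonneg_left h1 (show 0 ≤ 16 * F by linarith)
      have h5 := mul_le_mul_of_nonneg_left h2 hn
      linarith
    have h6 : 12 * F ≤ n * K := by
      refine le_of_mul_le_mul_right (a := L + 2) ?_ (by linarith)
      nlinarith
    refine le_of_mul_le_mul_right (a := K) ?_ (by linarith)
    have h7 : (6 * K ^ 2 - 8 * K) * K ≤ 12 * ((K - 1) ^ 2 * (K - 2)) := by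
      nlinarith [mul_nonneg (sq_nonneg K) (sub_nonneg.2 hk5z)]
    have h8 := mul_le_mul_of_nonneg_right h7 hfz.le
    have h9 := mul_le_mul_of_nonneg_left h6
      (mul_nonneg (sq_nonneg (K - 1)) (show 0 ≤ K - 2 by linarith))
    linarith

end Family

section Triple

variable {ℓ f : ℕ} {p q r : ℕ → V}

/-- `p` and `q` share a vertex at distance at least `f` from the ends of both. -/
def MeetDeep (ℓ f : ℕ) (p q : ℕ → V) : Prop :=
  ∃ a, f ≤ a ∧ a + f ≤ ℓ ∧ ∃ b, f ≤ b ∧ b + f ≤ ℓ ∧ p a = q b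

theorem MeetDeep.symm (h : MeetDeep ℓ f p q) : MeetDeep ℓ f q p := by
  obtain ⟨a, h1, h2, b, h3, h4, e⟩ := h
  exact ⟨b, h3, h4, a, h1, h2, e.symm⟩

variable [DecidableEq V]

/-- Along `p`, the vertices of `q` and those of `r` are at least `f` apart. -/
def Separates (ℓ f : ℕ) (p q r : ℕ → V) : Prop :=
  ∀ a ≤ ℓ, ∀ b ≤ ℓ, p a ∈ pathVerts ℓ q → p b ∈ pathVerts ℓ r → a + f ≤ b ∨ b + f ≤ a

theorem Separates.symm (h : Separates ℓ f p q r) : Separates ℓ f p r q :=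
  fun a ha b hb h1 h2 => (h b hb a ha h2 h1).symm

/-- Three longest paths any two of which meet only at distance at least `f` from the third. -/
structure SeparatedTriple (ℓ f : ℕ) (p q r : ℕ → V) : Prop where
  pq : IsLongestPair ℓ p q
  qp : IsLongestPair ℓ q p
  pr : IsLongestPair ℓ p r
  rp : IsLongestPair ℓ r p
  qr : IsLongestPair ℓ q r
  rq : IsLongestPair ℓ r q
  sep_p : Separates ℓ f p q r
  sep_q : Separates ℓ f q r p
  sep_r : Separates ℓ f r p q

/-- The vertices of `p` on neither `q` nor `r`. -/
def privateVerts (ℓ : ℕ) (p q r : ℕ → V) : Finset V :=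
  (pathVerts ℓ p).filter fun v => v ∉ pathVerts ℓ q ∧ v ∉ pathVerts ℓ r

theorem privateVerts_comm : privateVerts ℓ p q r = privateVerts ℓ p r q := by
  simp only [privateVerts, and_comm]

namespace SeparatedTriple

theorem rotate (h : SeparatedTriple ℓ f p q r) : SeparatedTriple ℓ f q r p :=
  ⟨h.qr, h.rq, h.qp, h.pq, h.rp, h.pr, h.sep_q, h.sep_r, h.sep_p⟩

theorem swap (h : SeparatedTriple ℓ f p q r) : SeparatedTriple ℓ f p r q :=
  ⟨h.pr, h.rp, h.pq, h.qp, h.rq, h.qr, h.sep_p.symm, h.sep_r.symm, h.sep_q.symm⟩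

theorem meetDeep_or (h : SeparatedTriple ℓ f p q r) : MeetDeep ℓ f p q ∨ MeetDeep ℓ f p r := by
  obtain ⟨a, ha, haq, -, b, hb, e, h1, h2⟩ := h.pq.exists_first
  obtain ⟨a', ha', har, -, b', hb', e', h1', h2'⟩ := h.pr.exists_first
  rcases h.sep_p a ha a' ha' haq har with h3 | h3
  · exact .inr ⟨a', by omega, by omega, b', by omega, by omega, e'⟩
  · exact .inl ⟨a, by omega, by omega, b, by omega, by omega, e⟩

theorem le_card_Ioo (h : SeparatedTriple ℓ f p q r) {x y : ℕ} (hxy : x < y) (hy : y ≤ ℓ)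
    (hx : p x ∈ pathVerts ℓ q ∧ p y ∈ pathVerts ℓ r ∨
      p x ∈ pathVerts ℓ r ∧ p y ∈ pathVerts ℓ q) :
    f ≤ ((Finset.Ioo x y).filter fun a =>
      p a ∉ pathVerts ℓ q ∧ p a ∉ pathVerts ℓ r).card + 1 := by
  rcases hx with ⟨h1, h2⟩ | ⟨h1, h2⟩
  · exact le_card_filter_Ioo_add_one (X := fun a => p a ∈ pathVerts ℓ q)
      (Y := fun a => p a ∈ pathVerts ℓ r) _ x y le_rfl hxy h1 h2
      fun a b _ _ _ _ => h.sep_p a (by omega) b (by omega)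
  · have := le_card_filter_Ioo_add_one (X := fun a => p a ∈ pathVerts ℓ r)
      (Y := fun a => p a ∈ pathVerts ℓ q) _ x y le_rfl hxy h1 h2
      fun a b _ _ _ _ => h.sep_p.symm a (by omega) b (by omega)
    simpa only [and_comm] using this

theorem two_mul_le_card_of_alternation (h : SeparatedTriple ℓ f p q r) {x y z : ℕ}
    (hxy : x < y) (hyz : y < z) (hz : z ≤ ℓ) (hx : p x ∈ pathVerts ℓ q)
    (hy : p y ∈ pathVerts ℓ r) (hzq : p z ∈ pathVerts ℓ q) :
    2 * f ≤ (privateVerts ℓ p q r).card + 2 := by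
  have h1 := h.le_card_Ioo hxy (by omega) (.inl ⟨hx, hy⟩)
  have h2 := h.le_card_Ioo hyz hz (.inr ⟨hy, hzq⟩)
  rw [privateVerts, ← h.pq.card_filter fun v => v ∉ pathVerts ℓ q ∧ v ∉ pathVerts ℓ r]
  have hd : Disjoint (Finset.Ioo x y) (Finset.Ioo y z) := by
    rw [Finset.disjoint_left]
    intro a
    simp only [Finset.mem_Ioo]
    omega
  have hsub : Finset.Ioo x y ∪ Finset.Ioo y z ⊆ Finset.range (ℓ + 1) := by
    intro a
    simp only [Finset.mem_union, Finset.mem_Ioo, Finset.mem_range]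
    omega
  have h3 := Finset.card_le_card (Finset.filter_subset_filter
    (fun a => p a ∉ pathVerts ℓ q ∧ p a ∉ pathVerts ℓ r) hsub)
  rw [Finset.filter_union, Finset.card_union_of_disjoint
    (Finset.disjoint_filter_filter hd)] at h3
  omega

theorem two_mul_le_card (h : SeparatedTriple ℓ f p q r) (hf : 0 < f) :
    2 * f ≤ (privateVerts ℓ p q r).card + 2 := by
  obtain ⟨a, ha, haq, -, b, hb, e, h1, h2⟩ := h.pq.exists_first
  obtain ⟨a', ha', har, -, b', hb', e', h1', h2'⟩ := h.pr.exists_first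
  obtain ⟨c, hc, hcq, -, h3⟩ := h.pq.exists_last
  obtain ⟨c', hc', hcr, -, h3'⟩ := h.pr.exists_last
  have h4 := h.sep_p a ha a' ha' haq har
  have h5 := h.sep_p a ha c' hc' haq hcr
  have h6 := h.sep_p c hc a' ha' hcq har
  by_cases hlt : a < a'
  · exact h.two_mul_le_card_of_alternation (x := a) (y := a') (z := c) hlt (by omega) hc haq har hcq
  · rw [privateVerts_comm]
    exact h.swap.two_mul_le_card_of_alternation (x := a') (y := a) (z := c') (by omega) (by omega)
      hc' har haq hcr

theorem three_mul_le_card_of_alternation (h : SeparatedTriple ℓ f p q r) {x y z w : ℕ}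
    (hxy : x < y) (hyz : y < z) (hzw : z < w) (hw : w ≤ ℓ) (hx : p x ∈ pathVerts ℓ r)
    (hy : p y ∈ pathVerts ℓ q) (hz : p z ∈ pathVerts ℓ r) (hwq : p w ∈ pathVerts ℓ q) :
    3 * f ≤ (privateVerts ℓ p q r).card + 3 := by
  have h1 := h.le_card_Ioo hxy (by omega) (.inr ⟨hx, hy⟩)
  have h2 := h.le_card_Ioo hyz (by omega) (.inl ⟨hy, hz⟩)
  have h3 := h.le_card_Ioo hzw hw (.inr ⟨hz, hwq⟩)
  rw [privateVerts, ← h.pq.card_filter fun v => v ∉ pathVerts ℓ q ∧ v ∉ pathVerts ℓ r]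
  have hd : Disjoint (Finset.Ioo x y) (Finset.Ioo y z) := by
    rw [Finset.disjoint_left]
    intro a
    simp only [Finset.mem_Ioo]
    omega
  have hd' : Disjoint (Finset.Ioo x y ∪ Finset.Ioo y z) (Finset.Ioo z w) := by
    rw [Finset.disjoint_left]
    intro a
    simp only [Finset.mem_union, Finset.mem_Ioo]
    omega
  have hsub : Finset.Ioo x y ∪ Finset.Ioo y z ∪ Finset.Ioo z w ⊆ Finset.range (ℓ + 1) := by
    intro a
    simp only [Finset.mem_union, Finset.mem_Ioo, Finset.mem_range]
    omega
  have h4 := Finset.card_le_card (Finset.filter_subset_filter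
    (fun a => p a ∉ pathVerts ℓ q ∧ p a ∉ pathVerts ℓ r) hsub)
  rw [Finset.filter_union, Finset.card_union_of_disjoint (Finset.disjoint_filter_filter hd'),
    Finset.filter_union, Finset.card_union_of_disjoint (Finset.disjoint_filter_filter hd)] at h4
  omega

/-- Three alternations cannot fill up a path of length exactly `3 f`. -/
theorem three_mul_lt_of_alternation (h : SeparatedTriple ℓ f p q r) (hf : 0 < f) {x y z w : ℕ}
    (hxy : x < y) (hyz : y < z) (hzw : z < w) (hw : w ≤ ℓ) (hx : p x ∈ pathVerts ℓ r)
    (hy : p y ∈ pathVerts ℓ q) (hz : p z ∈ pathVerts ℓ r) (hwq : p w ∈ pathVerts ℓ q) :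
    3 * f + 1 ≤ ℓ := by
  have h1 := h.sep_p y (by omega) x (by omega) hy hx
  have h2 := h.sep_p y (by omega) z (by omega) hy hz
  have h3 := h.sep_p w hw z (by omega) hwq hz
  by_contra hlt
  obtain rfl : x = 0 := by omega
  have hmem : ∀ u ≤ ℓ, p u ∈ pathVerts ℓ r → u = 0 ∨ u = z := by
    intro u hu hur
    have h4 := h.sep_p y (by omega) u hu hy hur
    have h5 := h.sep_p w hw u hu hwq hur
    omega
  have hback : ∀ c ≤ ℓ, ∀ a ≤ ℓ, p a = r c → p a = p 0 ∨ p a = p z := by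
    intro c hc a ha e
    rcases hmem a ha (mem_pathVerts.2 ⟨c, hc, e.symm⟩) with rfl | rfl
    · exact .inl rfl
    · exact .inr rfl
  obtain ⟨c, hc, e⟩ := mem_pathVerts.1 hx
  obtain ⟨c', hc', e'⟩ := mem_pathVerts.1 hz
  have hpos : ∀ d ≤ ℓ, r d ∈ pathVerts ℓ p → d = c ∨ d = c' := by
    intro d hd hdp
    obtain ⟨a, ha, hda⟩ := mem_pathVerts.1 hdp
    rcases hback d hd a ha hda with h4 | h4
    · exact .inl (h.rp.inj d hd c hc (by rw [← hda, h4, e]))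
    · exact .inr (h.rp.inj d hd c' hc' (by rw [← hda, h4, e']))
  obtain ⟨hnext, hprev⟩ := h.pr.start c hc e.symm
  have hn : c + 1 ≤ ℓ → c + 1 = c' := fun h4 => by
    obtain ⟨a, ha, hpa⟩ := hnext h4
    have := hpos (c + 1) h4 (mem_pathVerts.2 ⟨a, ha, hpa⟩)
    omega
  have hp : 1 ≤ c → c - 1 = c' := fun h4 => by
    obtain ⟨a, ha, hpa⟩ := hprev h4
    have := hpos (c - 1) (by omega) (mem_pathVerts.2 ⟨a, ha, hpa⟩)
    omega
  obtain ⟨s, hs, hsp, -, s', -, -, hs'⟩ := h.rp.exists_first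
  obtain ⟨t, ht, htp, -, ht'⟩ := h.rp.exists_last
  have := hpos s hs hsp
  have := hpos t ht htp
  omega

theorem long_or_alternation_of_lt (h : SeparatedTriple ℓ f p q r) (hf : 0 < f) {y z : ℕ}
    (hfy : f ≤ y) (hyz : y < z) (hfz : z + f ≤ ℓ) (hy : p y ∈ pathVerts ℓ q)
    (hz : p z ∈ pathVerts ℓ r) :
    4 * f ≤ ℓ ∨ 3 * f + 1 ≤ ℓ ∧ 3 * f ≤ (privateVerts ℓ p q r).card + 3 := by
  obtain ⟨x, hx, hxr, -, b, hb, -, h1⟩ := h.pr.exists_first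
  obtain ⟨w, hw, hwq, -, h2⟩ := h.pq.exists_last
  have h3 := h.sep_p y (by omega) x hx hy hxr
  have h4 := h.sep_p w hw z (by omega) hwq hz
  have h5 := h.sep_p y (by omega) z (by omega) hy hz
  by_cases hxy : x < y
  · by_cases hzw : z < w
    · exact .inr ⟨h.three_mul_lt_of_alternation hf hxy hyz hzw hw hxr hy hz hwq,
        h.three_mul_le_card_of_alternation hxy hyz hzw hw hxr hy hz hwq⟩
    · left; omega
  · left; omega

theorem long_or_alternation (h : SeparatedTriple ℓ f p q r) (hf : 0 < f)
    (hq : MeetDeep ℓ f p q) (hr : MeetDeep ℓ f p r) :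
    4 * f ≤ ℓ ∨ 3 * f + 1 ≤ ℓ ∧ 3 * f ≤ (privateVerts ℓ p q r).card + 3 := by
  obtain ⟨y, hy, hyℓ, b, hb, hbℓ, e⟩ := hq
  obtain ⟨z, hz, hzℓ, c, hc, hcℓ, e'⟩ := hr
  have hyq : p y ∈ pathVerts ℓ q := mem_pathVerts.2 ⟨b, by omega, e.symm⟩
  have hzr : p z ∈ pathVerts ℓ r := mem_pathVerts.2 ⟨c, by omega, e'.symm⟩
  have h1 := h.sep_p y (by omega) z (by omega) hyq hzr
  by_cases hyz : y < z
  · exact h.long_or_alternation_of_lt hf hy hyz hzℓ hyq hzr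
  · rw [privateVerts_comm]
    exact h.swap.long_or_alternation_of_lt hf hz (by omega) hyℓ hzr hyq

variable [Fintype V]

theorem three_mul_add_card_le (h : SeparatedTriple ℓ f p q r) (hf : 0 < f) :
    3 * (ℓ + 1) + (privateVerts ℓ p q r).card + (privateVerts ℓ q r p).card +
      (privateVerts ℓ r p q).card ≤ 2 * Fintype.card V := by
  have hno : ∀ v, ¬ (v ∈ pathVerts ℓ p ∧ v ∈ pathVerts ℓ q ∧ v ∈ pathVerts ℓ r) := by
    rintro v ⟨h1, h2, h3⟩
    obtain ⟨a, ha, rfl⟩ := mem_pathVerts.1 h1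
    have := h.sep_p a ha a ha h2 h3
    omega
  have hcard : ∀ S : Finset V, S.card = ∑ v, if v ∈ S then 1 else 0 := by simp
  calc _ = (pathVerts ℓ p).card + (pathVerts ℓ q).card + (pathVerts ℓ r).card +
        (privateVerts ℓ p q r).card + (privateVerts ℓ q r p).card +
        (privateVerts ℓ r p q).card := by
        rw [h.pq.card_pathVerts, h.qp.card_pathVerts, h.rp.card_pathVerts]; ring
    _ ≤ ∑ v : V, 2 := by
        simp only [hcard, ← Finset.sum_add_distrib]
        refine Finset.sum_le_sum fun v _ => ?_
        have := hno v
        simp only [privateVerts, Finset.mem_filter]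
        by_cases h1 : v ∈ pathVerts ℓ p <;> by_cases h2 : v ∈ pathVerts ℓ q <;>
          by_cases h3 : v ∈ pathVerts ℓ r <;> simp_all
    _ = 2 * Fintype.card V := by simp [mul_comm]

theorem fifteen_mul_le (h : SeparatedTriple ℓ f p q r) (hf : 0 < f) :
    15 * f ≤ 2 * Fintype.card V := by
  have hcount := h.three_mul_add_card_le hf
  have hp := h.two_mul_le_card hf
  have hq := h.rotate.two_mul_le_card hf
  have hr := h.rotate.rotate.two_mul_le_card hf
  have key : (MeetDeep ℓ f p q ∧ MeetDeep ℓ f p r) ∨ (MeetDeep ℓ f q r ∧ MeetDeep ℓ f q p) ∨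
      (MeetDeep ℓ f r p ∧ MeetDeep ℓ f r q) := by
    have h1 := h.meetDeep_or
    have h2 := h.rotate.meetDeep_or
    have h3 := h.rotate.rotate.meetDeep_or
    have s1 : MeetDeep ℓ f p q ↔ MeetDeep ℓ f q p := ⟨.symm, .symm⟩
    have s2 : MeetDeep ℓ f p r ↔ MeetDeep ℓ f r p := ⟨.symm, .symm⟩
    have s3 : MeetDeep ℓ f q r ↔ MeetDeep ℓ f r q := ⟨.symm, .symm⟩
    tauto
  rcases key with ⟨h1, h2⟩ | ⟨h1, h2⟩ | ⟨h1, h2⟩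
  · have := h.long_or_alternation hf h1 h2
    omega
  · have := h.rotate.long_or_alternation hf h1 h2
    omega
  · have := h.rotate.rotate.long_or_alternation hf h1 h2
    omega

end SeparatedTriple

end Triple

theorem distToWalk_le (G : SimpleGraph V) (x : V) {u v y : V} (w : G.Walk u v)
    (hy : y ∈ w.support) : distToWalk G x w ≤ G.dist x y :=
  Nat.sInf_le ⟨y, hy, rfl⟩

theorem dist_getVert_le {G : SimpleGraph V} {u v : V} (w : G.Walk u v) {a b : ℕ} (hab : a ≤ b) :
    G.dist (w.getVert a) (w.getVert b) ≤ b - a := by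
  have h := dist_le ((w.drop a).take (b - a))
  rw [Walk.take_length, Walk.drop_getVert, Nat.add_sub_cancel' hab] at h
  exact h.trans (min_le_left _ _)

end LongestPaths

/-- Theorem 3 (k longest paths): `(6k² - 8k)·f(G,𝒫) ≤ (k³ - 4k² + 5k - 2)·n`. -/
theorem k_longest_paths_bound {V : Type*} [Fintype V] (G : SimpleGraph V)
    (hG : G.Connected) (k : ℕ) (hk : 3 ≤ k)
    (P : Fin k → Σ u : V, Σ v : V, G.Walk u v)
    (hinj : Function.Injective P) (hlong : ∀ i, IsLongestPath G (P i).2.2) :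
    (6 * (k : ℤ) ^ 2 - 8 * (k : ℤ)) * (pdf G P : ℤ) ≤
      ((k : ℤ) ^ 3 - 4 * (k : ℤ) ^ 2 + 5 * (k : ℤ) - 2) * (Fintype.card V : ℤ) := by
  classical
  set ℓ := (P ⟨0, by omega⟩).2.2.length with hℓ
  have hlen : ∀ i, (P i).2.2.length = ℓ := fun i =>
    le_antisymm ((hlong _).2 _ _ _ (hlong i).1) ((hlong i).2 _ _ _ (hlong _).1)
  have hmax : ∀ m g, IsPathFun G m g → m ≤ ℓ := by
    intro m g hg
    obtain ⟨w, hw, hm⟩ := hg.exists_isPath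
    exact hm ▸ (hlong _).2 _ _ w hw
  set p : Fin k → ℕ → V := fun i => (P i).2.2.getVert
  have hpath : ∀ i, IsPathFun G ℓ (p i) := by
    intro i
    refine ⟨fun a ha b hb e => (hlong i).1.getVert_injOn ?_ ?_ e,
      fun a ha => (P i).2.2.adj_getVert_succ ?_⟩
    · simpa [hlen] using ha
    · simpa [hlen] using hb
    · rwa [hlen]
  have hp : ∀ i j, IsLongestPair ℓ (p i) (p j) := fun i j =>
    IsPathFun.isLongestPair hG hmax (hpath i) (hpath j)
  have hD : ∀ i j, ∀ a ≤ ℓ, ∀ b ≤ ℓ, p i b ∈ pathVerts ℓ (p j) →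
      distToWalk G (p i a) (P j).2.2 ≤ (b - a) + (a - b) := by
    intro i j a ha b hb hm
    obtain ⟨c, hc, e⟩ := mem_pathVerts.1 hm
    have hmem : p i b ∈ (P j).2.2.support := e ▸ Walk.getVert_mem_support _ c
    refine (distToWalk_le G _ _ hmem).trans ?_
    rcases le_total a b with h | h
    · exact (dist_getVert_le _ h).trans (by omega)
    · rw [dist_comm]
      exact (dist_getVert_le _ h).trans (by omega)
  have hf : ∀ v, pdf G P ≤ ∑ j, distToWalk G v (P j).2.2 := fun v => Nat.sInf_le ⟨v, rfl⟩
  rcases hk.eq_or_lt with rfl | hk4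
  · rcases Nat.eq_zero_or_pos (pdf G P) with h0 | hpos
    · rw [h0]
      norm_num
    have hzero : ∀ i, ∀ a ≤ ℓ, ∀ j, p i a ∈ pathVerts ℓ (p j) →
        distToWalk G (p i a) (P j).2.2 = 0 := fun i a ha j hm => by
      simpa using hD i j a ha a ha hm
    have hsep : ∀ i j l : Fin 3, (∀ F : Fin 3 → ℕ, ∑ x, F x = F i + F j + F l) →
        Separates ℓ (pdf G P) (p i) (p j) (p l) := by
      intro i j l hs a ha b hb hj hl
      have h1 := hf (p i a)
      rw [hs, hzero i a ha i (apply_mem_pathVerts ha), hzero i a ha j hj] at h1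
      have h2 := hD i l a ha b hb hl
      omega
    have htriple : SeparatedTriple ℓ (pdf G P) (p 0) (p 1) (p 2) :=
      ⟨hp _ _, hp _ _, hp _ _, hp _ _, hp _ _, hp _ _,
        hsep 0 1 2 fun F => Fin.sum_univ_three F,
        hsep 1 2 0 fun F => by rw [Fin.sum_univ_three]; ring,
        hsep 2 0 1 fun F => by rw [Fin.sum_univ_three]; ring⟩
    have := htriple.fifteen_mul_le hpos
    zify at this
    push_cast
    linarith
  · exact longestPaths_bound_of_four_le hp (D := fun j v => distToWalk G v (P j).2.2) hD hf hk4
end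

section
/- The following two statements are equivalent: (A) for every connected finite graph G and every set P of k longest paths of G with 3 ≤ k ≤ 6, the paths of P have a common vertex (equivalently f(G,P) = 0); (B) there exists a sublinear function g : ℕ → ℝ (i.e., g(n)/n → 0 as n → ∞) such that for every connected finite graph G of order n and every set P of k longest paths of G with 3 ≤ k ≤ 6, f(G,P) ≤ g(n). -/
open SimpleGraph

namespace SimpleGraph

section Walks

variable {W : Type*} {H : SimpleGraph W}

/-- Following a sequence `f` of vertices whose interior vertices have no other neighbours, a path
either ends before `f (i + n)` or reaches it. -/
theorem Walk.IsPath.length_lt_or_reaches (f : ℕ → W) (n : ℕ) : ∀ (i : ℕ) (x y : W)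
    (q : H.Walk x y), x = f (i + 1) →
    (∀ j, j < i + n → ∀ w, H.Adj (f (j + 1)) w → w = f j ∨ w = f (j + 2)) →
    q.IsPath → f i ∉ q.support →
    q.length < n ∨ ∃ q₁ : H.Walk (f (i + n + 1)) y, q₁.IsPath ∧ q₁.support ⊆ q.support ∧
      q.length = n + q₁.length ∧ ∀ j, i < j → j ≤ i + n → H.Adj (f j) (f (j + 1)) := by
  induction n with
  | zero =>
    rintro i x y q rfl - hq -
    exact Or.inr ⟨q, hq, List.Subset.refl _, by simp, by omega⟩
  | succ n ih =>
    rintro i x y q rfl hf hq hi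
    cases q with
    | nil => exact Or.inl (by simp)
    | @cons _ w _ h q =>
      rw [Walk.cons_isPath_iff] at hq
      rcases hf i (by omega) w h with rfl | rfl
      · simp at hi
      · rcases ih (i + 1) _ y q rfl (fun j hj ↦ hf j (by omega)) hq.1 hq.2 with hlt | h'
        · exact Or.inl (by simpa using hlt)
        · rw [show i + 1 + n = i + (n + 1) by omega] at h'
          obtain ⟨q₁, hq₁, hsub, hlen, hadj⟩ := h'
          refine Or.inr ⟨q₁, hq₁, fun z hz ↦ ?_, by simp [hlen]; omega, fun j hj hj' ↦ ?_⟩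
          · exact List.mem_cons_of_mem _ (hsub hz)
          · rcases Nat.lt_or_ge (i + 1) j with h1 | h1
            · exact hadj j h1 hj'
            · obtain rfl : j = i + 1 := by omega
              exact h

/-- Prepending the vertices `f 0, …, f (n - 1)` to a path starting at `f n`. -/
theorem Walk.IsPath.exists_prepend (f : ℕ → W) (n : ℕ) {x : W} (hx : f 0 = x) :
    ∀ {z y : W} {q : H.Walk z y}, q.IsPath → f n = z →
    (∀ i < n, H.Adj (f i) (f (i + 1))) → (∀ i < n, ∀ j < n, f i = f j → i = j) →
    (∀ i < n, f i ∉ q.support) →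
    ∃ q' : H.Walk x y, q'.IsPath ∧ q'.length = n + q.length ∧
      q'.support = (List.range n).map f ++ q.support := by
  subst hx
  induction n with
  | zero =>
    rintro z y q hq rfl - - -
    exact ⟨q, hq, by simp, by simp⟩
  | succ n ih =>
    rintro z y q hq rfl hadj hinj hdis
    obtain ⟨q', hq', hlen, hsup⟩ := ih (q := Walk.cons (hadj n (by omega)) q)
      (by rw [Walk.cons_isPath_iff]; exact ⟨hq, hdis n (by omega)⟩) rfl
      (fun i hi ↦ hadj i (by omega)) (fun i hi j hj ↦ hinj i (by omega) j (by omega))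
      (fun i hi h ↦ by
        rw [Walk.support_cons, List.mem_cons] at h
        rcases h with h | h
        · have := hinj i (by omega) n (by omega) h
          omega
        · exact hdis i (by omega) h)
    refine ⟨q', hq', by rw [hlen, Walk.length_cons]; omega, ?_⟩
    rw [hsup, List.range_succ]
    simp

theorem Walk.le_add_length {φ : W → ℕ} (hφ : ∀ x y, H.Adj x y → φ x ≤ φ y + 1) {x y : W}
    (q : H.Walk x y) : φ x ≤ φ y + q.length := by
  induction q with
  | nil => simp
  | cons h q ih =>
    have := hφ _ _ h
    rw [Walk.length_cons]
    omega

theorem Walk.sigma_ext_support {X Y : Σ u : W, Σ v : W, H.Walk u v}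
    (h : X.2.2.support = Y.2.2.support) : X = Y := by
  obtain ⟨u, v, p⟩ := X
  obtain ⟨u', v', p'⟩ := Y
  dsimp only at h
  obtain rfl : u = u' := by
    rw [← Walk.cons_tail_support p, ← Walk.cons_tail_support p'] at h
    exact (List.cons.inj h).1
  obtain rfl : v = v' := by
    have h1 := p.getLast_support
    have h2 := p'.getLast_support
    simp only [h] at h1
    exact h1.symm.trans h2
  rw [Walk.ext_support h]

end Walks

section Lanes

variable {V : Type} {t : ℕ}

/-- The vertices of the lane of the pair `(u, v)`: first `u`, then `t` new vertices, then `v`. -/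
def lane (t : ℕ) (u v : V) : ℕ → V ⊕ V × V × Fin t
  | 0 => Sum.inl u
  | j + 1 => if h : j < t then Sum.inr (u, v, ⟨j, h⟩) else Sum.inl v

theorem lane_eq_inl {u v w : V} {i : ℕ} :
    lane t u v i = Sum.inl w ↔ i = 0 ∧ u = w ∨ t < i ∧ v = w := by
  cases i with
  | zero => simp [lane]
  | succ i =>
    by_cases h : i < t
    · simp [lane, h]
    · simp [lane, h]
      omega

theorem lane_eq_inr {u v a b : V} {i : ℕ} {j : Fin t} :
    lane t u v i = Sum.inr (a, b, j) ↔ u = a ∧ v = b ∧ i = j + 1 := by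
  cases i with
  | zero => simp [lane]
  | succ i =>
    by_cases h : i < t
    · simp [lane, h, Fin.ext_iff]
    · simp [lane, h]; omega

theorem lane_succ {u v : V} {j : ℕ} (h : j < t) :
    lane t u v (j + 1) = Sum.inr (u, v, ⟨j, h⟩) := by
  simp [lane, h]

theorem lane_last (u v : V) : lane t u v (t + 1) = Sum.inl v := by
  simp [lane]

/-- The graph obtained from `G` by replacing every arc `(u, v)` by a path with `t` interior
vertices, and attaching to `u` a pendant path with `t` new vertices for every pair `(u, v)`
of non-adjacent vertices. -/
def laneGraph (G : SimpleGraph V) (t : ℕ) : SimpleGraph (V ⊕ V × V × Fin t) where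
  Adj x y := ∃ u v j, (j < t ∨ j = t ∧ G.Adj u v) ∧
    (x = lane t u v j ∧ y = lane t u v (j + 1) ∨ y = lane t u v j ∧ x = lane t u v (j + 1))
  symm := ⟨fun x y ⟨u, v, j, h, h'⟩ ↦ ⟨u, v, j, h, h'.symm⟩⟩
  loopless := ⟨fun x ⟨u, v, j, h, h'⟩ ↦ by
    have h1 : lane t u v j = lane t u v (j + 1) := by
      rcases h' with h' | h' <;> exact h'.1.symm.trans h'.2
    rcases h with h | ⟨rfl, h⟩
    · rw [lane_succ h, lane_eq_inr] at h1
      simp at h1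
    · rw [lane_last, lane_eq_inl] at h1
      rcases h1 with h1 | h1
      · exact h.ne h1.2
      · omega⟩

variable {G : SimpleGraph V}

theorem laneGraph_adj_lane {u v : V} {j : ℕ} (h : j < t ∨ j = t ∧ G.Adj u v) :
    (laneGraph G t).Adj (lane t u v j) (lane t u v (j + 1)) :=
  ⟨u, v, j, h, Or.inl ⟨rfl, rfl⟩⟩

/-- A sequence of vertices of `laneGraph G t` running along a lane from `a` to `b`. -/
def IsLane (G : SimpleGraph V) (t : ℕ) (f : ℕ → V ⊕ V × V × Fin t) (a b : V) : Prop :=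
  f 0 = Sum.inl a ∧ f (t + 1) = Sum.inl b ∧
  (∀ j < t, ∀ w, (laneGraph G t).Adj (f (j + 1)) w → w = f j ∨ w = f (j + 2)) ∧
  ((∀ j ≤ t, (laneGraph G t).Adj (f j) (f (j + 1))) → G.Adj a b)

theorem isLane_lane (ht : 2 ≤ t) (u v : V) : IsLane G t (lane t u v) u v := by
  refine ⟨rfl, lane_last u v, ?_, ?_⟩
  · rintro j hj w ⟨u', v', k, -, ⟨h1, rfl⟩ | ⟨rfl, h1⟩⟩
    · rw [lane_succ hj, eq_comm, lane_eq_inr] at h1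
      obtain ⟨rfl, rfl, rfl⟩ := h1
      exact Or.inr rfl
    · rw [lane_succ hj, eq_comm, lane_eq_inr] at h1
      obtain ⟨rfl, rfl, h1⟩ := h1
      obtain rfl : k = j := by simpa using h1
      exact Or.inl rfl
  · intro h
    obtain ⟨t, rfl⟩ : ∃ s, t = s + 2 := ⟨t - 2, by omega⟩
    have h := h (t + 2) le_rfl
    rw [lane_last, lane_succ (j := t + 1) (by omega)] at h
    obtain ⟨u', v', j, hj, ⟨h1, h2⟩ | ⟨h1, h2⟩⟩ := h
    · rw [eq_comm, lane_eq_inr] at h1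
      obtain ⟨rfl, rfl, rfl⟩ := h1
      simpa using hj
    · rw [eq_comm, lane_eq_inr] at h2
      rw [eq_comm, lane_eq_inl] at h1
      simp only at h2
      omega

theorem IsLane.symm {f : ℕ → V ⊕ V × V × Fin t} {a b : V} (hf : IsLane G t f a b) :
    IsLane G t (fun j ↦ f (t + 1 - j)) b a := by
  obtain ⟨h0, h1, h2, h3⟩ := hf
  refine ⟨by simpa using h1, by simpa using h0, fun j hj w hw ↦ ?_, fun h ↦ (h3 fun j hj ↦ ?_).symm⟩
  · have h := h2 (t - 1 - j) (by omega) w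
    rw [show t - 1 - j + 1 = t + 1 - (j + 1) by omega,
      show t - 1 - j + 2 = t + 1 - j by omega,
      show t - 1 - j = t + 1 - (j + 2) by omega] at h
    exact (h hw).symm
  · have h := (h (t - j) (by omega)).symm
    dsimp only at h
    rwa [show t + 1 - (t - j) = j + 1 by omega, show t + 1 - (t - j + 1) = j by omega] at h

theorem exists_isLane_of_adj_inl (ht : 2 ≤ t) {a : V} {w : V ⊕ V × V × Fin t}
    (h : (laneGraph G t).Adj (Sum.inl a) w) : ∃ f b, IsLane G t f a b ∧ w = f 1 := by
  obtain ⟨u, v, j, hj, ⟨h1, rfl⟩ | ⟨rfl, h1⟩⟩ := h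
  · rw [eq_comm, lane_eq_inl] at h1
    obtain ⟨rfl, rfl⟩ : j = 0 ∧ u = a := by
      rcases h1 with h1 | h1
      · exact h1
      · omega
    exact ⟨_, _, isLane_lane ht u v, rfl⟩
  · rw [eq_comm, lane_eq_inl] at h1
    obtain ⟨rfl, rfl⟩ : j = t ∧ v = a := by
      refine ⟨by omega, ?_⟩
      rcases h1 with h1 | h1
      · omega
      · exact h1.2
    exact ⟨_, _, (isLane_lane ht u v).symm, rfl⟩

theorem Walk.IsPath.exists_path_of_inl (ht : 2 ≤ t) (n : ℕ) :
    ∀ {a : V} {y} (q : (laneGraph G t).Walk (Sum.inl a) y), q.IsPath → q.length ≤ n →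
      ∃ b, ∃ p : G.Walk a b, p.IsPath ∧ q.length ≤ (t + 1) * p.length + t ∧
        ∀ w ∈ p.support, Sum.inl w ∈ q.support := by
  induction n with
  | zero => exact fun {a} {y} q hq hn ↦ ⟨a, Walk.nil, by simp, by omega, by simp⟩
  | succ n ih =>
    intro a y q hq hn
    cases q with
    | nil => exact ⟨a, Walk.nil, by simp, by simp, by simp⟩
    | @cons _ w _ h q =>
      rw [Walk.cons_isPath_iff] at hq
      rw [Walk.length_cons] at hn
      obtain ⟨f, b, ⟨h0, h1, h2, h3⟩, hw⟩ := exists_isLane_of_adj_inl ht h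
      rcases hq.1.length_lt_or_reaches f t 0 w y q hw (by simpa using h2) (h0 ▸ hq.2) with hlt | h'
      · exact ⟨a, Walk.nil, by simp, by rw [Walk.length_cons]; simp; omega, by simp⟩
      · rw [Nat.zero_add, h1] at h'
        obtain ⟨q₁, hq₁, hsub, hlen, hadj⟩ := h'
        obtain ⟨c, p, hp, hle, hmem⟩ := ih q₁ hq₁ (by omega)
        have hab : G.Adj a b := h3 fun j hj ↦ by
          rcases Nat.eq_zero_or_pos j with rfl | hj'
          · rw [h0, Nat.zero_add, ← hw]
            exact h
          · exact hadj j hj' hj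
        refine ⟨c, Walk.cons hab p, ?_, ?_, ?_⟩
        · rw [Walk.cons_isPath_iff]
          exact ⟨hp, fun ha ↦ hq.2 (hsub (hmem a ha))⟩
        · rw [Walk.length_cons, Walk.length_cons, mul_add]
          omega
        · intro w hw
          rw [Walk.support_cons, List.mem_cons] at hw ⊢
          rcases hw with rfl | hw
          · exact Or.inl rfl
          · exact Or.inr (hsub (hmem w hw))

theorem Walk.IsPath.length_le_of_inl (ht : 2 ≤ t) {L : ℕ}
    (hL : ∀ (a b : V) (p : G.Walk a b), p.IsPath → p.length ≤ L) {a : V} {y}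
    {q : (laneGraph G t).Walk (Sum.inl a) y} (hq : q.IsPath) : q.length ≤ (t + 1) * L + t := by
  obtain ⟨b, p, hp, hle, -⟩ := IsPath.exists_path_of_inl ht _ q hq le_rfl
  exact hle.trans (Nat.add_le_add_right (Nat.mul_le_mul_left _ (hL a b p hp)) _)

theorem IsLane.length_lt (ht : 2 ≤ t) {L : ℕ}
    (hL : ∀ (a b : V) (p : G.Walk a b), p.IsPath → p.length ≤ L)
    {f : ℕ → V ⊕ V × V × Fin t} {a b : V} (hf : IsLane G t f a b) {j : ℕ} (hj : j < t) {x y}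
    {q : (laneGraph G t).Walk x y} (hx : x = f (j + 2)) (hq : q.IsPath)
    (hmem : f (j + 1) ∉ q.support) : q.length < (t + 1) * L + 2 * t := by
  obtain ⟨h0, h1, h2, -⟩ := hf
  rcases hq.length_lt_or_reaches f (t - (j + 1)) (j + 1) x y q hx
    (fun k hk ↦ h2 k (by omega)) hmem with hlt | h'
  · omega
  · rw [show j + 1 + (t - (j + 1)) + 1 = t + 1 by omega, h1] at h'
    obtain ⟨q₁, hq₁, -, hlen, -⟩ := h'
    have := hq₁.length_le_of_inl ht hL
    omega

theorem Walk.IsPath.length_le_laneGraph (ht : 2 ≤ t) {L : ℕ}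
    (hL : ∀ (a b : V) (p : G.Walk a b), p.IsPath → p.length ≤ L) {x y}
    (q : (laneGraph G t).Walk x y) (hq : q.IsPath) : q.length ≤ (t + 1) * L + 2 * t := by
  obtain a | ⟨u, v, j, hj⟩ := x
  · have := hq.length_le_of_inl ht hL
    omega
  · cases q with
    | nil => simp
    | @cons _ w _ h q =>
      rw [Walk.cons_isPath_iff, ← lane_succ hj] at hq
      rw [Walk.length_cons]
      have hl : IsLane G t (lane t u v) u v := isLane_lane ht u v
      rcases hl.2.2.1 j hj w (by rwa [lane_succ hj]) with hw | hw
      · refine hl.symm.length_lt ht hL (j := t - 1 - j) (by omega) ?_ hq.1 ?_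
        · rw [hw]
          congr 1
          omega
        · rw [show t + 1 - (t - 1 - j + 1) = j + 1 by omega]
          exact hq.2
      · exact hl.length_lt ht hL hj hw hq.1 hq.2

theorem lane_injOn {u v : V} {i j : ℕ} (hi : i ≤ t) (hj : j ≤ t)
    (h : lane t u v i = lane t u v j) : i = j := by
  cases j with
  | zero =>
    rw [lane, lane_eq_inl] at h
    omega
  | succ j =>
    rw [lane_succ (by omega), lane_eq_inr] at h
    simpa using h.2.2

theorem filterMap_getLeft?_lane (u v : V) {n : ℕ} (hn : n ≤ t) :
    ((List.range (n + 1)).map (lane t u v)).filterMap Sum.getLeft? = [u] := by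
  induction n with
  | zero => simp [lane]
  | succ n ih =>
    rw [List.range_succ, List.map_append, List.filterMap_append, ih (by omega)]
    simp [lane, show n < t by omega]

theorem eq_and_eq_of_inr_mem_lane {u v a b : V} {l : List ℕ} {j : Fin t}
    (h : Sum.inr (a, b, j) ∈ l.map (lane t u v)) : u = a ∧ v = b := by
  obtain ⟨i, -, h⟩ := List.mem_map.1 h
  rw [lane_eq_inr] at h
  exact ⟨h.1, h.2.1⟩

theorem mem_of_inl_mem {l : List (V ⊕ V × V × Fin t)} {l' : List V}
    (h : l.filterMap Sum.getLeft? = l') {w : V} (hw : Sum.inl w ∈ l) : w ∈ l' := by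
  rw [← h, List.mem_filterMap]
  exact ⟨_, hw, rfl⟩

/-- A path of `G` lifts to a path of `laneGraph G t` which is extended by the pendant path at its
last vertex. -/
theorem Walk.IsPath.exists_lift {a b : V} {p : G.Walk a b} (hp : p.IsPath) :
    ∃ q : (laneGraph G t).Walk (Sum.inl a) (lane t b b t), q.IsPath ∧
      q.length = (t + 1) * p.length + t ∧
      q.support.filterMap Sum.getLeft? = p.support ∧
      ∀ u v j, Sum.inr (u, v, j) ∈ q.support →
        u ∈ p.support ∧ v ∈ p.support ∧ (u = v → u = b) := by
  induction p with
  | @nil b =>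
    obtain ⟨q, hq, hlen, hsup⟩ :=
      (IsPath.nil (G := laneGraph G t) (u := lane t b b t)).exists_prepend
      (lane t b b) t (x := Sum.inl b) rfl rfl (fun i hi ↦ laneGraph_adj_lane (Or.inl hi))
      (fun i hi j hj ↦ lane_injOn (by omega) (by omega))
      (fun i hi h ↦ by
        have := lane_injOn (by omega) le_rfl (List.mem_singleton.1 h)
        omega)
    have hsup' : q.support = (List.range (t + 1)).map (lane t b b) := by
      rw [hsup, List.range_succ]
      simp
    refine ⟨q, hq, by simpa using hlen, by
      rw [hsup', filterMap_getLeft?_lane b b le_rfl, Walk.support_nil], ?_⟩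
    intro u v j h
    rw [hsup'] at h
    obtain ⟨rfl, rfl⟩ := eq_and_eq_of_inr_mem_lane h
    simp
  | @cons u v b h p ih =>
    rw [Walk.cons_isPath_iff] at hp
    obtain ⟨q₀, hq₀, hlen₀, hfm₀, hinr₀⟩ := ih hp.1
    obtain ⟨q, hq, hlen, hsup⟩ := hq₀.exists_prepend
      (lane t u v) (t + 1) (x := Sum.inl u) rfl (lane_last u v)
      (fun i hi ↦ laneGraph_adj_lane (by
        rcases Nat.lt_or_ge i t with h' | h'
        · exact Or.inl h'
        · exact Or.inr ⟨by omega, h⟩))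
      (fun i hi j hj ↦ lane_injOn (by omega) (by omega))
      (fun i hi h' ↦ by
        cases i with
        | zero => exact hp.2 (mem_of_inl_mem hfm₀ h')
        | succ i =>
          rw [lane_succ (by omega)] at h'
          exact hp.2 (hinr₀ _ _ _ h').1)
    refine ⟨q, hq, ?_, ?_, ?_⟩
    · rw [hlen, hlen₀, Walk.length_cons, mul_add]
      omega
    · rw [hsup, List.filterMap_append, filterMap_getLeft?_lane u v le_rfl, hfm₀]
      simp
    · intro u' v' j hj
      rw [hsup, List.mem_append] at hj
      rw [Walk.support_cons, List.mem_cons, List.mem_cons]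
      rcases hj with hj | hj
      · obtain ⟨rfl, rfl⟩ := eq_and_eq_of_inr_mem_lane hj
        exact ⟨Or.inl rfl, Or.inr p.start_mem_support, fun h' ↦ (h.ne h').elim⟩
      · obtain ⟨h1, h2, h3⟩ := hinr₀ _ _ _ hj
        exact ⟨Or.inr h1, Or.inr h2, h3⟩

/-- A path of `G` lifts to a path of `laneGraph G t` which is extended by the pendant paths at
both of its ends. -/
theorem Walk.IsPath.exists_lift_pendant {a b : V} (hab : a ≠ b) {p : G.Walk a b} (hp : p.IsPath) :
    ∃ q : (laneGraph G t).Walk (lane t a a t) (lane t b b t), q.IsPath ∧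
      q.length = (t + 1) * p.length + 2 * t ∧
      q.support.filterMap Sum.getLeft? = p.support ∧
      ∀ u v j, Sum.inr (u, v, j) ∈ q.support → u ∈ p.support ∧ v ∈ p.support := by
  obtain ⟨q₀, hq₀, hlen₀, hfm₀, hinr₀⟩ := hp.exists_lift (t := t)
  have hsucc : ∀ i < t, ∃ h : t - 1 - i < t,
      lane t a a (t - i) = Sum.inr (a, a, ⟨t - 1 - i, h⟩) := fun i hi ↦
    ⟨by omega, by rw [← lane_succ]; congr 1; omega⟩
  obtain ⟨q, hq, hlen, hsup⟩ := hq₀.exists_prepend (fun i ↦ lane t a a (t - i)) t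
    (x := lane t a a t) rfl (by simp [lane])
    (fun i hi ↦ by
      have := laneGraph_adj_lane (G := G) (u := a) (v := a) (j := t - (i + 1))
        (t := t) (Or.inl (by omega))
      rw [show t - (i + 1) + 1 = t - i by omega] at this
      exact this.symm)
    (fun i hi j hj h ↦ by
      have := lane_injOn (by omega) (by omega) h
      omega)
    (fun i hi h ↦ by
      obtain ⟨h', heq⟩ := hsucc i hi
      rw [heq] at h
      exact hab ((hinr₀ _ _ _ h).2.2 rfl))
  refine ⟨q, hq, by rw [hlen, hlen₀]; omega, ?_, ?_⟩
  · rw [hsup, List.filterMap_append, hfm₀, List.append_left_eq_self,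
      List.filterMap_eq_nil_iff]
    intro z hz
    obtain ⟨i, hi, rfl⟩ := List.mem_map.1 hz
    obtain ⟨h', heq⟩ := hsucc i (List.mem_range.1 hi)
    rw [heq, Sum.getLeft?_inr]
  · intro u v j h
    rw [hsup, List.mem_append] at h
    rcases h with h | h
    · obtain ⟨i, hi, h⟩ := List.mem_map.1 h
      rw [lane_eq_inr] at h
      obtain ⟨rfl, rfl, -⟩ := h
      exact ⟨p.start_mem_support, p.start_mem_support⟩
    · exact ⟨(hinr₀ _ _ _ h).1, (hinr₀ _ _ _ h).2.1⟩

theorem laneGraph_connected (hG : G.Connected) : (laneGraph G t).Connected := by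
  have hlane : ∀ u v j, (j ≤ t ∨ G.Adj u v) → j ≤ t + 1 →
      (laneGraph G t).Reachable (Sum.inl u) (lane t u v j) := by
    intro u v j h hj
    induction j with
    | zero => exact Reachable.refl _
    | succ j ih =>
      refine (ih (Or.inl (by omega)) (by omega)).trans (laneGraph_adj_lane ?_).reachable
      rcases Nat.lt_or_ge j t with h' | h'
      · exact Or.inl h'
      · exact Or.inr ⟨by omega, h.resolve_left (by omega)⟩
  have hinl : ∀ u v, (laneGraph G t).Reachable (Sum.inl u) (Sum.inl v) := by
    intro u v
    obtain ⟨p⟩ := hG.preconnected u v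
    induction p with
    | nil => exact Reachable.refl _
    | @cons u v _ h p ih =>
      refine Reachable.trans ?_ ih
      rw [← lane_last (t := t) u v]
      exact hlane u v _ (Or.inr h) le_rfl
  have hall : ∀ u x, (laneGraph G t).Reachable (Sum.inl u) x := by
    rintro u (v | ⟨v, w, j, hj⟩)
    · exact hinl u v
    · rw [← lane_succ hj]
      exact (hinl u v).trans (hlane v w _ (Or.inl (by omega)) (by omega))
  obtain ⟨u⟩ := hG.nonempty
  exact (connected_iff _).2 ⟨fun x y ↦ (hall u x).symm.trans (hall u y), ⟨Sum.inl u⟩⟩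

open Classical in
/-- A Lipschitz function on `laneGraph G t` measuring how far a vertex is from `v` and the
pendant paths attached to `v`. -/
noncomputable def potential (G : SimpleGraph V) (t : ℕ) (v : V) : V ⊕ V × V × Fin t → ℕ
  | Sum.inl w => if w = v then 0 else t + 1
  | Sum.inr (a, b, j) =>
    if a = v then (if G.Adj a b then j + 1 else 0)
    else if b = v ∧ G.Adj a b then t - j else t + 1

theorem potential_le_of_adj {v : V} {x y : V ⊕ V × V × Fin t} (h : (laneGraph G t).Adj x y) :
    potential G t v x ≤ potential G t v y + 1 := by
  have hstep : ∀ a b j, (j < t ∨ j = t ∧ G.Adj a b) →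
      potential G t v (lane t a b j) ≤ potential G t v (lane t a b (j + 1)) + 1 ∧
      potential G t v (lane t a b (j + 1)) ≤ potential G t v (lane t a b j) + 1 := by
    intro a b j hj
    by_cases hab : G.Adj a b
    · have hne := hab.ne
      rcases j with _ | j <;> by_cases ha : a = v <;> by_cases hb : b = v <;>
        simp only [lane] <;> split_ifs <;> simp [potential, *] <;> grind
    · have hj : j < t := by tauto
      rcases j with _ | j <;> by_cases ha : a = v <;>
        simp only [lane] <;> split_ifs <;> simp [potential, *] <;> grind
  obtain ⟨a, b, j, hj, ⟨rfl, rfl⟩ | ⟨rfl, rfl⟩⟩ := h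
  · exact (hstep a b j hj).1
  · exact (hstep a b j hj).2

theorem exists_two_mul_potential_le (x : V ⊕ V × V × Fin t) :
    ∃ v, 2 * potential G t v x ≤ t + 1 := by
  obtain u | ⟨a, b, j⟩ := x
  · exact ⟨u, by simp [potential]⟩
  · by_cases hab : G.Adj a b
    · by_cases hj : 2 * (j.val + 1) ≤ t + 1
      · exact ⟨a, by simpa [potential, hab] using hj⟩
      · refine ⟨b, ?_⟩
        simp [potential, hab, hab.ne]
        omega
    · exact ⟨a, by simp [potential, hab]⟩

end Lanes

end SimpleGraph

theorem pdf_eq_zero_of_common_vertex {V : Type*} (G : SimpleGraph V) {k : ℕ}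
    {P : Fin k → Σ u : V, Σ v : V, G.Walk u v} {x : V} (hx : ∀ i, x ∈ (P i).2.2.support) :
    pdf G P = 0 := by
  have h : ∀ i, distToWalk G x (P i).2.2 = 0 := fun i ↦
    Nat.sInf_eq_zero.2 (Or.inl ⟨x, hx i, SimpleGraph.dist_self⟩)
  exact Nat.sInf_eq_zero.2 (Or.inl ⟨x, by simp [h]⟩)

/-- Longest paths without a common vertex yield longest paths of `laneGraph G t` without a vertex
close to all of them. -/
theorem exists_le_pdf_laneGraph {V : Type} {G : SimpleGraph V} (hG : G.Connected) {k : ℕ}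
    {P : Fin k → Σ u : V, Σ v : V, G.Walk u v} (hinj : Function.Injective P)
    (hP : ∀ i, IsLongestPath G (P i).2.2) (hno : ¬ ∃ x : V, ∀ i, x ∈ (P i).2.2.support)
    {t : ℕ} (ht : 2 ≤ t) :
    ∃ Q : Fin k → Σ u : V ⊕ V × V × Fin t, Σ v : V ⊕ V × V × Fin t, (laneGraph G t).Walk u v,
      Function.Injective Q ∧ (∀ i, IsLongestPath (laneGraph G t) (Q i).2.2) ∧
        t + 1 ≤ 2 * pdf (laneGraph G t) Q := by
  push Not at hno
  have hne : ∀ i, (P i).1 ≠ (P i).2.1 := by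
    intro i h
    have hlen : (P i).2.2.length = 0 := by
      have hp := (hP i).1
      generalize (P i).2.2 = p at hp
      generalize (P i).2.1 = v at p h
      subst h
      exact SimpleGraph.Walk.length_eq_zero_iff.2 (SimpleGraph.Walk.isPath_iff_nil.1 hp)
    obtain ⟨j, hj⟩ := hno (P i).1
    obtain ⟨q, hq⟩ := (hG.preconnected (P i).1 (P j).1).exists_isPath
    have h0 : q.length = 0 := by
      have := (hP i).2 _ _ q hq
      omega
    rw [SimpleGraph.Walk.eq_of_length_eq_zero h0] at hj
    exact hj (P j).2.2.start_mem_support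
  choose q hq hlen hfm hinr using fun i ↦ (hP i).1.exists_lift_pendant (t := t) (hne i)
  refine ⟨fun i ↦ ⟨_, _, q i⟩, fun i j hij ↦ ?_, fun i ↦ ⟨hq i, fun a b r hr ↦ ?_⟩, ?_⟩
  · apply hinj
    apply SimpleGraph.Walk.sigma_ext_support
    rw [← hfm i, ← hfm j]
    exact congrArg (fun X : Σ u : V ⊕ V × V × Fin t, Σ v : V ⊕ V × V × Fin t,
      (laneGraph G t).Walk u v ↦ X.2.2.support.filterMap Sum.getLeft?) hij
  · rw [hlen i]
    exact hr.length_le_laneGraph ht (fun a b p hp ↦ (hP i).2 a b p hp)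
  · have hC : (laneGraph G t).Connected := laneGraph_connected hG
    obtain ⟨u⟩ := hG.nonempty
    obtain ⟨x, hx⟩ : pdf (laneGraph G t) (fun i ↦ ⟨_, _, q i⟩) ∈ _ :=
      Nat.sInf_mem ⟨_, Sum.inl u, rfl⟩
    obtain ⟨v, hv⟩ := exists_two_mul_potential_le (G := G) x
    obtain ⟨i, hi⟩ := hno v
    obtain ⟨y, hy, hd⟩ : distToWalk (laneGraph G t) x (q i) ∈ _ :=
      Nat.sInf_mem ⟨_, _, (q i).start_mem_support, rfl⟩
    have hle : distToWalk (laneGraph G t) x (q i) ≤ pdf (laneGraph G t) (fun i ↦ ⟨_, _, q i⟩) := by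
      rw [hx]
      exact Finset.single_le_sum (f := fun i ↦ distToWalk (laneGraph G t) x (q i))
        (fun _ _ ↦ Nat.zero_le _) (Finset.mem_univ i)
    have hpot : potential G t v y = t + 1 := by
      obtain w | ⟨a, b, j⟩ := y
      · have hw : w ≠ v := fun h ↦ hi (h ▸ mem_of_inl_mem (hfm i) hy)
        simp [potential, hw]
      · have hab := hinr i a b j hy
        have ha : a ≠ v := fun h ↦ hi (h ▸ hab.1)
        have hb : b ≠ v := fun h ↦ hi (h ▸ hab.2)
        simp [potential, ha, hb]
    obtain ⟨r, hr⟩ := hC.exists_walk_length_eq_dist y x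
    have := r.le_add_length (φ := potential G t v) fun _ _ h ↦ potential_le_of_adj h
    rw [SimpleGraph.dist_comm] at hr
    omega

/-- Theorem 10: Conjecture 8 (any `k` longest paths, `3 ≤ k ≤ 6`, of a connected graph
have a common vertex) holds if and only if Conjecture 9 (there is a sublinear function
`g` with `f(G,𝒫) ≤ g(n)` for every connected graph `G` of order `n` and every family
`𝒫` of `k` longest paths, `3 ≤ k ≤ 6`) holds. -/
theorem common_vertex_iff_sublinear_bound :
    (∀ (V : Type) [Fintype V] (G : SimpleGraph V), G.Connected →
      ∀ (k : ℕ), 3 ≤ k → k ≤ 6 →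
        ∀ P : Fin k → Σ u : V, Σ v : V, G.Walk u v,
          Function.Injective P → (∀ i, IsLongestPath G (P i).2.2) →
            ∃ x : V, ∀ i, x ∈ (P i).2.2.support) ↔
    (∃ g : ℕ → ℝ,
      Filter.Tendsto (fun n : ℕ => g n / (n : ℝ)) Filter.atTop (nhds 0) ∧
      ∀ (V : Type) [Fintype V] (G : SimpleGraph V), G.Connected →
        ∀ (k : ℕ), 3 ≤ k → k ≤ 6 →
          ∀ P : Fin k → Σ u : V, Σ v : V, G.Walk u v,
            Function.Injective P → (∀ i, IsLongestPath G (P i).2.2) →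
              (pdf G P : ℝ) ≤ g (Fintype.card V)) := by
  constructor
  · intro hA
    refine ⟨fun _ ↦ 0, by simp, fun V _ G hG k hk hk' P hinj hP ↦ ?_⟩
    obtain ⟨x, hx⟩ := hA V G hG k hk hk' P hinj hP
    simp [pdf_eq_zero_of_common_vertex G hx]
  · rintro ⟨g, hg, hB⟩ V _ G hG k hk hk' P hinj hP
    by_contra hno
    have := hG.nonempty
    set N := Fintype.card V with hN
    have hN0 : 0 < N := Fintype.card_pos
    have hcard : ∀ t, Fintype.card (V ⊕ V × V × Fin t) = N + N * (N * t) := by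
      intro t
      simp [hN]
    have hev := hg.eventually (gt_mem_nhds (show (0 : ℝ) < 1 / (2 * (N + N * N)) by positivity))
    obtain ⟨m, hm⟩ := Filter.eventually_atTop.1 hev
    set t := m + 2
    obtain ⟨Q, hQ, hQ', hle⟩ := exists_le_pdf_laneGraph hG hinj hP hno (t := t) (by omega)
    have hub := hB _ (laneGraph G t) (laneGraph_connected hG) k hk hk' Q hQ hQ'
    rw [hcard] at hub
    have ht : m ≤ N + N * (N * t) := by
      have : t ≤ N * (N * t) := by
        rw [← mul_assoc]
        exact Nat.le_mul_of_pos_left t (by positivity)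
      omega
    have hlt := hm _ ht
    have hpos : (0 : ℝ) < ((N + N * (N * t) : ℕ) : ℝ) := by
      have : 0 < N + N * (N * t) := by omega
      exact_mod_cast this
    rw [div_lt_div_iff₀ hpos (by positivity)] at hlt
    have hle' : ((t : ℝ) + 1) ≤ 2 * pdf (laneGraph G t) Q := by exact_mod_cast hle
    have hN' : (0 : ℝ) < N := by exact_mod_cast hN0
    have h1 : ((t : ℝ) + 1) * (N + N * N) ≤ g (N + N * (N * t)) * (2 * (N + N * N)) := by
      have : 0 ≤ (N : ℝ) + N * N := by positivity
      nlinarith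
    push_cast at hlt
    have h2 : (0 : ℝ) ≤ N * t := by positivity
    nlinarith
end
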